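/- arXiv:0904.0848 — 2 statements merged into one kernel-verified Lean document; each statement's English description precedes it below -/
import Mathlib

section
/- Let K be a compact metrizable group and let α, β be two commuting continuous automorphisms of K such that Z(α, β), the group of all continuous automorphisms of K commuting with both α and β, has DCC on K. If α is ergodic on K, then α^i β is ergodic on K for all but finitely many integers i > 0. -/
open MeasureTheory Topology Set

set_option linter.unusedVariables false

namespace ErgZd

variable {K : Type*}

/-- The group of bi-continuous automorphisms of a topological group,
as a subgroup of `MulAut K`. -/
def ContAut (K : Type*) [Group K] [TopologicalSpace K] : Subgroup (MulAut K) where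
  carrier := {α | Continuous α ∧ Continuous α.symm}
  one_mem' := ⟨continuous_id, continuous_id⟩
  mul_mem' := fun {a b} ha hb => ⟨ha.1.comp hb.1, hb.2.comp ha.2⟩
  inv_mem' := fun {a} ha => ⟨ha.2, ha.1⟩

section Defs

variable [Group K] [TopologicalSpace K]

lemma ContAut.continuous (α : ↥(ContAut K)) : Continuous ⇑(α : MulAut K) := α.2.1

lemma ContAut.continuous_symm (α : ↥(ContAut K)) :
    Continuous ⇑(α : MulAut K).symm := α.2.2

/-- Ergodicity of the action of a set `S` of automorphisms with respect to `μ`: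
every invariant Borel set is null or conull. -/
def ErgSet [MeasurableSpace K] (μ : Measure K) (S : Set ↥(ContAut K)) : Prop :=
  ∀ A : Set K, MeasurableSet A → (∀ α ∈ S, (α : MulAut K) '' A = A) → μ A = 0 ∨ μ A = 1

/-- Ergodicity of a single automorphism: ergodicity of the group of its integer powers. -/
def ErgAut [MeasurableSpace K] (μ : Measure K) (α : ↥(ContAut K)) : Prop :=
  ErgSet μ (Set.range fun n : ℤ => α ^ n)

/-- Distality of the action of a set of automorphisms: for `x ≠ 1`, the identity is
not in the closure of the orbit of `x`. -/
def DistalSet (S : Set ↥(ContAut K)) : Prop :=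
  ∀ x : K, x ≠ 1 → (1 : K) ∉ closure ((fun α : ↥(ContAut K) => (α : MulAut K) x) '' S)

/-- Distality of a single automorphism. -/
def DistalAut (α : ↥(ContAut K)) : Prop := DistalSet (Set.range fun n : ℤ => α ^ n)

/-- The descending chain condition for an action: every decreasing
sequence of closed invariant subgroups is eventually constant. -/
def HasDCC (S : Set ↥(ContAut K)) : Prop :=
  ∀ C : ℕ → Subgroup K, (∀ n, IsClosed (C n : Set K)) → (∀ n, C (n + 1) ≤ C n) →
    (∀ n, ∀ α ∈ S, ∀ x, x ∈ C n ↔ (α : MulAut K) x ∈ C n) → ∃ N, ∀ n, N ≤ n → C n = C N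

/-- Restriction of an automorphism to an invariant subgroup. -/
def restrictAut (H : Subgroup K) (α : ↥(ContAut K))
    (h : ∀ x, x ∈ H ↔ (α : MulAut K) x ∈ H) : ↥(ContAut ↥H) := by
  refine ⟨⟨⟨fun x => ⟨(α : MulAut K) x, (h x).mp x.2⟩,
      fun x => ⟨(α : MulAut K).symm x, (h _).mpr (by simpa using x.2)⟩, ?_, ?_⟩, ?_⟩, ?_, ?_⟩
  · intro x; ext; simp
  · intro x; ext; simp
  · intro x y; ext; simp
  · exact Continuous.subtype_mk ((ContAut.continuous α).comp continuous_subtype_val) _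
  · exact Continuous.subtype_mk ((ContAut.continuous_symm α).comp continuous_subtype_val) _

@[simp] lemma restrictAut_coe (H : Subgroup K) (α : ↥(ContAut K))
    (h : ∀ x, x ∈ H ↔ (α : MulAut K) x ∈ H) (x : ↥H) :
    ((((restrictAut H α h) : MulAut ↥H) x : ↥H) : K) = (α : MulAut K) (x : K) := rfl

/-- The automorphism induced on the quotient by an invariant closed normal subgroup. -/
def quotAut (N : Subgroup K) [N.Normal] (α : ↥(ContAut K))
    (h : ∀ x, x ∈ N ↔ (α : MulAut K) x ∈ N) : ↥(ContAut (K ⧸ N)) := by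
  have hmap : N.map ((α : MulAut K) : K ≃* K) = N := by
    ext y
    constructor
    · rintro ⟨x, hx, rfl⟩; exact (h x).mp hx
    · intro hy
      exact ⟨(α : MulAut K).symm y, (h _).mpr (by simpa using hy), by simp⟩
  refine ⟨QuotientGroup.congr N N ((α : MulAut K) : K ≃* K) hmap, ?_, ?_⟩
  · apply (QuotientGroup.isQuotientMap_mk N).continuous_iff.mpr
    have : ⇑(QuotientGroup.congr N N ((α : MulAut K) : K ≃* K) hmap) ∘ (QuotientGroup.mk : K → K ⧸ N)
        = (QuotientGroup.mk : K → K ⧸ N) ∘ ⇑(α : MulAut K) := by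
      funext x
      exact QuotientGroup.congr_mk N N _ hmap x
    rw [this]
    exact QuotientGroup.continuous_mk.comp (ContAut.continuous α)
  · apply (QuotientGroup.isQuotientMap_mk N).continuous_iff.mpr
    have : ⇑(QuotientGroup.congr N N ((α : MulAut K) : K ≃* K) hmap).symm ∘ (QuotientGroup.mk : K → K ⧸ N)
        = (QuotientGroup.mk : K → K ⧸ N) ∘ ⇑((α : MulAut K) : K ≃* K).symm := by
      funext x
      rfl
    rw [this]
    exact QuotientGroup.continuous_mk.comp (ContAut.continuous_symm α)

end Defs

section Topological

open scoped Pointwise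

variable [Group K] [TopologicalSpace K]

/-- `γ` acts equicontinuously modulo `M`: points close to `1` have their whole `γ`-orbit
close to `M`. -/
def EquicontMod (γ : ↥(ContAut K)) (M : Subgroup K) : Prop :=
  ∀ W : Set K, IsOpen W → (M : Set K) ⊆ W →
    ∀ᶠ x in 𝓝 (1 : K), ∀ m : ℤ, ((γ ^ m : ↥(ContAut K)) : MulAut K) x ∈ W

/-- `M` is a closed normal subgroup that is invariant under the automorphisms in `Λ`. -/
structure IsClosedNormalInv (Λ : Set ↥(ContAut K)) (M : Subgroup K) : Prop where
  isClosed : IsClosed (M : Set K)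
  normal : M.Normal
  mem_iff : ∀ τ ∈ Λ, ∀ x, x ∈ M ↔ (τ : MulAut K) x ∈ M

lemma coe_mul_apply (γ δ : ↥(ContAut K)) (x : K) :
    ((γ * δ : ↥(ContAut K)) : MulAut K) x = (γ : MulAut K) ((δ : MulAut K) x) := rfl

lemma zpow_add_apply (γ : ↥(ContAut K)) (m n : ℤ) (x : K) :
    ((γ ^ (m + n) : ↥(ContAut K)) : MulAut K) x
      = ((γ ^ m : ↥(ContAut K)) : MulAut K) (((γ ^ n : ↥(ContAut K)) : MulAut K) x) := by
  rw [zpow_add, coe_mul_apply]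

lemma zpow_zero_apply (γ : ↥(ContAut K)) (x : K) :
    ((γ ^ (0 : ℤ) : ↥(ContAut K)) : MulAut K) x = x := rfl

lemma zpow_apply_zpow_neg (γ : ↥(ContAut K)) (m : ℤ) (x : K) :
    ((γ ^ m : ↥(ContAut K)) : MulAut K) (((γ ^ (-m) : ↥(ContAut K)) : MulAut K) x) = x := by
  rw [← zpow_add_apply, add_neg_cancel, zpow_zero_apply]

lemma EquicontMod.mono {γ : ↥(ContAut K)} {M M' : Subgroup K} (h : EquicontMod γ M)
    (hM : M ≤ M') : EquicontMod γ M' :=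
  fun W hW hMW => h W hW (Subset.trans hM hMW)

lemma IsClosedNormalInv.mem_zpow_iff {Λ : Set ↥(ContAut K)} {M : Subgroup K}
    (hM : IsClosedNormalInv Λ M) {γ : ↥(ContAut K)} (hγ : γ ∈ Λ) (m : ℤ) (x : K) :
    x ∈ M ↔ ((γ ^ m : ↥(ContAut K)) : MulAut K) x ∈ M := by
  induction m using Int.induction_on generalizing x with
  | zero => rw [zpow_zero_apply]
  | succ n ih =>
    rw [zpow_add_apply, ← ih, zpow_one]
    exact hM.mem_iff γ hγ x
  | pred n ih =>
    have hx := zpow_apply_zpow_neg γ 1 x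
    rw [zpow_one] at hx
    rw [sub_eq_add_neg, zpow_add_apply, ← ih,
      hM.mem_iff γ hγ (((γ ^ (-1 : ℤ) : ↥(ContAut K)) : MulAut K) x), hx]

lemma IsClosedNormalInv.inf {Λ : Set ↥(ContAut K)} {M N : Subgroup K}
    (hM : IsClosedNormalInv Λ M) (hN : IsClosedNormalInv Λ N) :
    IsClosedNormalInv Λ (M ⊓ N) where
  isClosed := hM.isClosed.inter hN.isClosed
  normal := by
    have := hM.normal
    have := hN.normal
    infer_instance
  mem_iff τ hτ x := and_congr (hM.mem_iff τ hτ x) (hN.mem_iff τ hτ x)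

lemma IsClosedNormalInv.top (Λ : Set ↥(ContAut K)) : IsClosedNormalInv Λ (⊤ : Subgroup K) where
  isClosed := isClosed_univ
  normal := inferInstance
  mem_iff _ _ _ := ⟨fun _ => trivial, fun _ => trivial⟩

lemma IsClosedNormalInv.finsetInf {ι : Type*} {Λ : Set ↥(ContAut K)} {N : ι → Subgroup K}
    (hN : ∀ i, IsClosedNormalInv Λ (N i)) (s : Finset ι) : IsClosedNormalInv Λ (s.inf N) := by
  classical
  induction s using Finset.induction_on with
  | empty => simpa using IsClosedNormalInv.top Λ
  | insert i s _ ih => simpa using (hN i).inf ih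

lemma EquicontMod.of_zpow {Λ : Set ↥(ContAut K)} {M : Subgroup K}
    (hM : IsClosedNormalInv Λ M) {α : ↥(ContAut K)} (hα : α ∈ Λ) {a : ℤ} (ha : a ≠ 0)
    (h : EquicontMod (α ^ a) M) : EquicontMod α M := by
  intro W hW hMW
  set W' : Set K := ⋂ r ∈ Set.Ico (0 : ℤ) |a|, ((α ^ r : ↥(ContAut K)) : MulAut K) ⁻¹' W
  have hW'o : IsOpen W' := (Set.finite_Ico _ _).isOpen_biInter
    fun r _ => hW.preimage (ContAut.continuous _)
  filter_upwards [h W' hW'o (Set.subset_iInter₂ fun r _ y hy =>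
    hMW ((hM.mem_zpow_iff hα r y).1 hy))] with x hx m
  have hmem := Set.mem_iInter₂.1 (hx (m / a)) (m % a)
    ⟨Int.emod_nonneg m ha, Int.emod_lt_abs m ha⟩
  rwa [Set.mem_preimage, ← zpow_mul, ← zpow_add_apply, Int.emod_add_mul_ediv] at hmem

variable [IsTopologicalGroup K] [CompactSpace K]

lemma IsClosedNormalInv.sup {Λ : Set ↥(ContAut K)} {M N : Subgroup K}
    (hM : IsClosedNormalInv Λ M) (hN : IsClosedNormalInv Λ N) :
    IsClosedNormalInv Λ (M ⊔ N) := by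
  have := hM.normal
  have := hN.normal
  refine ⟨?_, inferInstance, fun τ hτ x => ?_⟩
  · rw [Subgroup.mul_normal]
    exact hN.isClosed.mul_left_of_isCompact hM.isClosed.isCompact
  · simp only [Subgroup.mem_sup_of_normal_right]
    constructor
    · rintro ⟨y, hy, z, hz, rfl⟩
      exact ⟨_, (hM.mem_iff τ hτ y).1 hy, _, (hN.mem_iff τ hτ z).1 hz, (map_mul _ _ _).symm⟩
    · rintro ⟨y, hy, z, hz, h⟩
      refine ⟨(τ : MulAut K).symm y, (hM.mem_iff τ hτ _).2 (by simpa using hy),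
        (τ : MulAut K).symm z, (hN.mem_iff τ hτ _).2 (by simpa using hz), ?_⟩
      rw [← map_mul, h, MulEquiv.symm_apply_apply]

/-- If `D N = K` with `D`, `N` closed, then a neighbourhood of `1` in `D` spans, together
with `N`, a neighbourhood of `1` in `K`. -/
lemma eventually_exists_mul_of_sup_eq_top [T2Space K] {D N : Subgroup K} [N.Normal]
    (hD : IsClosed (D : Set K)) (hN : IsClosed (N : Set K)) (hDN : D ⊔ N = ⊤) {V : Set K}
    (hV : V ∈ 𝓝 (1 : K)) :
    ∀ᶠ x in 𝓝 (1 : K), ∃ d ∈ D, d ∈ V ∧ ∃ n ∈ N, d * n = x := by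
  obtain ⟨V', hV'V, hV'o, h1⟩ := mem_nhds_iff.1 hV
  set E : Set K := (D : Set K) \ (V' * ((D ⊓ N : Subgroup K) : Set K))
  have hEc : IsCompact E := (hD.sdiff hV'o.mul_right).isCompact
  have hclosed : IsClosed (E * (N : Set K)) := hN.mul_left_of_isCompact hEc
  have h1E : (1 : K) ∉ E * (N : Set K) := by
    rintro ⟨d, ⟨hd, hd'⟩, n, hn, hdn⟩
    have hdN : d ∈ N := by
      rw [eq_inv_of_mul_eq_one_left hdn]
      exact N.inv_mem hn
    exact hd' ⟨1, h1, d, ⟨hd, hdN⟩, one_mul d⟩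
  filter_upwards [hclosed.isOpen_compl.mem_nhds h1E] with x hx
  have hxt : x ∈ D ⊔ N := hDN ▸ Subgroup.mem_top x
  rw [← SetLike.mem_coe, Subgroup.mul_normal] at hxt
  obtain ⟨d, hd, n, hn, rfl⟩ := hxt
  have hdE : d ∈ V' * ((D ⊓ N : Subgroup K) : Set K) := by
    by_contra hcon
    exact hx ⟨d, ⟨hd, hcon⟩, n, hn, rfl⟩
  obtain ⟨v, hv, e, he, hve⟩ := hdE
  refine ⟨v, ?_, hV'V hv, e * n, N.mul_mem he.2 hn, ?_⟩
  · rw [show v = d * e⁻¹ by rw [← hve]; simp]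
    exact D.mul_mem hd (D.inv_mem he.1)
  · rw [← mul_assoc]
    exact congrArg (· * n) hve

lemma EquicontMod.inf_sup [T2Space K] {Λ : Set ↥(ContAut K)} {D N M : Subgroup K}
    (hD : IsClosedNormalInv Λ D) (hN : IsClosedNormalInv Λ N) (hM : IsClosedNormalInv Λ M)
    (hDN : D ⊔ N = ⊤) {γ : ↥(ContAut K)} (hγ : γ ∈ Λ) (h : EquicontMod γ M) :
    EquicontMod γ ((D ⊓ M) ⊔ N) := by
  intro W hW hsub
  have := hN.normal
  obtain ⟨U, hU, hUW⟩ := compact_open_separated_mul_left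
    ((hD.inf hM).sup hN).isClosed.isCompact hW hsub
  obtain ⟨U', hU'U, hU'o, h1⟩ := mem_nhds_iff.1 hU
  set E : Set K := (D : Set K) \ (U' * ((D ⊓ M : Subgroup K) : Set K))
  have hEc : IsClosed E := hD.isClosed.sdiff hU'o.mul_right
  have hME : (M : Set K) ⊆ Eᶜ := fun y hy hyE =>
    hyE.2 ⟨1, h1, y, ⟨hyE.1, hy⟩, one_mul y⟩
  filter_upwards [eventually_exists_mul_of_sup_eq_top hD.isClosed hN.isClosed hDN
    (h _ hEc.isOpen_compl hME)] with x hx m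
  obtain ⟨d, hd, hdV, n, hn, rfl⟩ := hx
  have hd' : ((γ ^ m : ↥(ContAut K)) : MulAut K) d ∈ U' * ((D ⊓ M : Subgroup K) : Set K) := by
    by_contra hcon
    exact hdV m ⟨(hD.mem_zpow_iff hγ m d).1 hd, hcon⟩
  obtain ⟨u, hu, e, he, hue⟩ := hd'
  refine hUW ⟨u, hU'U hu, e * ((γ ^ m : ↥(ContAut K)) : MulAut K) n,
    Subgroup.mul_mem_sup he ((hN.mem_zpow_iff hγ m n).1 hn), ?_⟩
  simp only at hue ⊢
  rw [← mul_assoc, hue, map_mul]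

lemma EquicontMod.mul_inv {Λ : Set ↥(ContAut K)} {M N : Subgroup K}
    (hM : IsClosedNormalInv Λ M) (hN : IsClosedNormalInv Λ N) (hNM : N ≤ M)
    {γ δ : ↥(ContAut K)} (hγ : γ ∈ Λ) (hcomm : Commute γ δ)
    (hγM : EquicontMod γ M) (hδN : EquicontMod δ N) : EquicontMod (γ * δ⁻¹) M := by
  intro W hW hMW
  obtain ⟨U, hU, hUW⟩ := compact_open_separated_mul_left hM.isClosed.isCompact hW hMW
  obtain ⟨U', hU'U, hU'o, h1⟩ := mem_nhds_iff.1 hU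
  have hev := hγM (U' * (M : Set K)) hU'o.mul_right fun y hy => ⟨1, h1, y, hy, one_mul y⟩
  obtain ⟨V, hVsub, hVo, hV1⟩ := mem_nhds_iff.1 hev
  filter_upwards [hδN (V * (N : Set K)) hVo.mul_right
    fun y hy => ⟨1, hV1, y, hy, one_mul y⟩] with x hx m
  obtain ⟨v, hv, n, hn, hvn⟩ := hx (-m)
  obtain ⟨u, hu, y, hy, huy⟩ := hVsub hv m
  simp only at hvn huy
  rw [(hcomm.inv_right).mul_zpow, coe_mul_apply, inv_zpow', ← hvn, map_mul, ← huy, mul_assoc]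
  exact hUW ⟨u, hU'U hu, _, M.mul_mem hy (hNM ((hN.mem_zpow_iff hγ m n).1 hn)), rfl⟩

/-- Let the automorphisms `γ i` pairwise share no common equicontinuous quotient, and let `γ i` act
equicontinuously modulo `N i`. Then `γ j` acts equicontinuously on no proper quotient of `K` by a
subgroup containing a finite intersection of `N i` with `i ≠ j`. -/
lemma eq_top_of_finsetInf_le [T2Space K] {ι : Type*} {Λ : Set ↥(ContAut K)}
    {γ : ι → ↥(ContAut K)} {N : ι → Subgroup K} (hγ : ∀ i, γ i ∈ Λ)
    (hN : ∀ i, IsClosedNormalInv Λ (N i)) (hγN : ∀ i, EquicontMod (γ i) (N i))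
    (hpair : ∀ i j, i ≠ j → ∀ M, IsClosedNormalInv Λ M → N i ≤ M → EquicontMod (γ j) M → M = ⊤)
    (s : Finset ι) : ∀ j ∉ s, ∀ M, IsClosedNormalInv Λ M → s.inf N ≤ M →
      EquicontMod (γ j) M → M = ⊤ := by
  classical
  induction s using Finset.induction_on with
  | empty => intro j _ M _ hle _; simpa using hle
  | insert i s his ih =>
    intro j hj M hM hle hjM
    rw [Finset.mem_insert, not_or] at hj
    rw [Finset.inf_insert] at hle
    set D := s.inf N
    have hD : IsClosedNormalInv Λ D := IsClosedNormalInv.finsetInf hN s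
    have hDN : D ⊔ N i = ⊤ :=
      ih i his _ (hD.sup (hN i)) le_sup_left ((hγN i).mono le_sup_right)
    have hND : N i ⊔ D = ⊤ := sup_comm D (N i) ▸ hDN
    have h₁ : (D ⊓ M) ⊔ N i = ⊤ :=
      hpair i j (Ne.symm hj.1) _ ((hD.inf hM).sup (hN i)) le_sup_right
        (hjM.inf_sup hD (hN i) hM hDN (hγ j))
    have h₂ : (N i ⊓ M) ⊔ D = ⊤ :=
      ih j hj.2 _ (((hN i).inf hM).sup hD) le_sup_right
        (hjM.inf_sup (hN i) hD hM hND (hγ j))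
    have key : ∀ A B : Subgroup K, B.Normal → (A ⊓ M) ⊔ B = ⊤ → A ⊓ B ≤ M → A ≤ M := by
      intro A B hB hAB hM' x hx
      have hxt : x ∈ (A ⊓ M) ⊔ B := hAB ▸ Subgroup.mem_top x
      rw [← SetLike.mem_coe, Subgroup.mul_normal] at hxt
      obtain ⟨y, hy, z, hz, rfl⟩ := hxt
      exact M.mul_mem hy.2 (hM' ⟨(Subgroup.mul_mem_cancel_left A hy.1).1 hx, hz⟩)
    rw [eq_top_iff, ← hDN]
    exact sup_le (key D (N i) (hN i).normal h₁ (inf_comm D (N i) ▸ hle))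
      (key (N i) D hD.normal h₂ hle)

end Topological

section Kernel

variable [Group K] [TopologicalSpace K]

/-- The subgroup of all `x` that act trivially by translations on the translates of the
continuous `γ`-invariant functions. -/
def invariantKernel (γ : ↥(ContAut K)) : Subgroup K where
  carrier := {x | ∀ F : K → ℝ, Continuous F →
    (∀ (m : ℤ) y, F (((γ ^ m : ↥(ContAut K)) : MulAut K) y) = F y) →
    ∀ b c, F (b * x * c) = F (b * c)}
  one_mem' F _ _ b c := by rw [mul_one]
  mul_mem' {x y} hx hy F hF hinv b c := by
    rw [← hx F hF hinv b c, ← hy F hF hinv (b * x) c]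
    simp only [mul_assoc]
  inv_mem' {x} hx F hF hinv b c := by
    rw [← hx F hF hinv (b * x⁻¹) c, inv_mul_cancel_right]

lemma invariantKernel_isClosedNormalInv [IsTopologicalGroup K] {Λ : Set ↥(ContAut K)}
    {γ : ↥(ContAut K)} (hγ : ∀ τ ∈ Λ, Commute τ γ) :
    IsClosedNormalInv Λ (invariantKernel γ) where
  isClosed := by
    change IsClosed {x | ∀ F : K → ℝ, Continuous F →
      (∀ (m : ℤ) y, F (((γ ^ m : ↥(ContAut K)) : MulAut K) y) = F y) →
      ∀ b c, F (b * x * c) = F (b * c)}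
    simp only [Set.ofPred_forall]
    refine isClosed_iInter fun F => isClosed_iInter fun hF => isClosed_iInter fun _ =>
      isClosed_iInter fun b => isClosed_iInter fun c => isClosed_eq (by fun_prop) continuous_const
  normal := ⟨fun x hx g F hF hinv b c => by
    have := hx F hF hinv (b * g) (g⁻¹ * c)
    simpa [mul_assoc] using this⟩
  mem_iff τ hτ x := by
    have hcomm : ∀ (m : ℤ) (y : K), (τ : MulAut K) (((γ ^ m : ↥(ContAut K)) : MulAut K) y)
        = ((γ ^ m : ↥(ContAut K)) : MulAut K) ((τ : MulAut K) y) := fun m y => by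
      rw [← coe_mul_apply, ← coe_mul_apply, ((hγ τ hτ).zpow_right m).eq]
    have hcomm' : ∀ (m : ℤ) (y : K),
        (τ : MulAut K).symm (((γ ^ m : ↥(ContAut K)) : MulAut K) y)
        = ((γ ^ m : ↥(ContAut K)) : MulAut K) ((τ : MulAut K).symm y) := fun m y => by
      rw [MulEquiv.symm_apply_eq, hcomm, MulEquiv.apply_symm_apply]
    constructor
    · intro hx F hF hinv b c
      have := hx (F ∘ (τ : MulAut K)) (hF.comp (ContAut.continuous τ))
        (fun m y => by simp only [Function.comp, hcomm, hinv])
        ((τ : MulAut K).symm b) ((τ : MulAut K).symm c)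
      simpa using this
    · intro hx F hF hinv b c
      have := hx (F ∘ (τ : MulAut K).symm) (hF.comp (ContAut.continuous_symm τ))
        (fun m y => by simp only [Function.comp, hcomm', hinv])
        ((τ : MulAut K) b) ((τ : MulAut K) c)
      simpa using this

lemma equicontMod_invariantKernel [IsTopologicalGroup K] [CompactSpace K]
    (γ : ↥(ContAut K)) : EquicontMod γ (invariantKernel γ) := by
  intro W hW hsub
  suffices h : ∀ᶠ x in 𝓝 (1 : K), ∀ m : ℤ, ((γ ^ m : ↥(ContAut K)) : MulAut K) x ∉ Wᶜ by
    simpa using h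
  refine hW.isClosed_compl.isCompact.induction_on
    (p := fun s => ∀ᶠ x in 𝓝 (1 : K), ∀ m : ℤ, ((γ ^ m : ↥(ContAut K)) : MulAut K) x ∉ s)
    (by simp) (fun s t hst ht => ht.mono fun x hx m hm => hx m (hst hm))
    (fun s t hs ht => by
      filter_upwards [hs, ht] with x hxs hxt m hm
      exact hm.elim (hxs m) (hxt m)) fun y hy => ?_
  have hy' : y ∉ invariantKernel γ := fun h => hy (hsub h)
  obtain ⟨F, hF, hinv, b, c, hne⟩ : ∃ F : K → ℝ, Continuous F ∧
      (∀ (m : ℤ) z, F (((γ ^ m : ↥(ContAut K)) : MulAut K) z) = F z) ∧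
      ∃ b c, F (b * y * c) ≠ F (b * c) := by
    by_contra! hcon
    exact hy' hcon
  set ε := |F (b * y * c) - F (b * c)| / 2 with hε
  have hpos : 0 < |F (b * y * c) - F (b * c)| := abs_pos.2 (sub_ne_zero.2 hne)
  refine ⟨{z | ε < |F (b * z * c) - F (b * c)|}, mem_nhdsWithin_of_mem_nhds
    ((isOpen_lt continuous_const (by fun_prop)).mem_nhds
      (show ε < |F (b * y * c) - F (b * c)| by linarith)), ?_⟩
  have hev : ∀ᶠ x in 𝓝 (1 : K), ∀ p ∈ (Set.univ : Set (K × K)),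
      |F (p.1 * x * p.2) - F (p.1 * p.2)| < ε := by
    refine isCompact_univ.eventually_forall_of_forall_eventually fun p _ => ?_
    have hcont : Continuous fun q : K × (K × K) =>
      |F (q.2.1 * q.1 * q.2.2) - F (q.2.1 * q.2.2)| := by fun_prop
    refine (isOpen_lt hcont continuous_const).mem_nhds ?_
    simp only [Set.mem_ofPred_eq, mul_one, sub_self, abs_zero]
    linarith
  filter_upwards [hev] with x hx m hm
  have hlt := hx (((γ ^ (-m) : ↥(ContAut K)) : MulAut K) b,
    ((γ ^ (-m) : ↥(ContAut K)) : MulAut K) c) trivial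
  rw [← hinv m, ← hinv m (_ * _)] at hlt
  simp only [map_mul, zpow_apply_zpow_neg] at hlt
  exact lt_asymm hlt hm

end Kernel

section Ergodic

variable [Group K] [TopologicalSpace K] [IsTopologicalGroup K] [CompactSpace K]
  [TopologicalSpace.MetrizableSpace K] [MeasurableSpace K] [BorelSpace K]
  (μ : Measure K) [μ.IsHaarMeasure] [IsProbabilityMeasure μ]

lemma eq_top_of_ergAut {α : ↥(ContAut K)} (hα : ErgAut μ α) {M : Subgroup K}
    (hM : IsClosed (M : Set K)) (h : EquicontMod α M) : M = ⊤ := by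
  rw [Subgroup.eq_top_iff']
  by_contra! hcon
  obtain ⟨x, hx⟩ := hcon
  obtain ⟨U, V, hU, hV, hMU, hxV, hUV⟩ :=
    SeparatedNhds.of_isCompact_isCompact hM.isCompact isCompact_singleton
      (Set.disjoint_singleton_right.2 hx)
  set A : Set K := {y | ∀ m : ℤ, ((α ^ m : ↥(ContAut K)) : MulAut K) y ∈ Vᶜ} with hA
  have hAc : IsClosed A := by
    simp only [hA, Set.ofPred_forall]
    exact isClosed_iInter fun m => hV.isClosed_compl.preimage (ContAut.continuous _)
  have hmaps : ∀ (n : ℤ) y, y ∈ A → ((α ^ n : ↥(ContAut K)) : MulAut K) y ∈ A :=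
    fun n y hy m => by rw [← zpow_add_apply]; exact hy (m + n)
  have hinv : ∀ τ ∈ Set.range fun n : ℤ => α ^ n, (τ : MulAut K) '' A = A := by
    rintro _ ⟨n, rfl⟩
    refine Subset.antisymm (Set.image_subset_iff.2 (hmaps n)) fun y hy =>
      ⟨_, hmaps (-n) y hy, zpow_apply_zpow_neg α n y⟩
  have hnhds : A ∈ 𝓝 (1 : K) := by
    filter_upwards [h U hU hMU] with y hy m
    exact Set.disjoint_left.1 hUV (hy m)
  rcases hα A hAc.measurableSet hinv with h0 | h1
  · exact (Measure.measure_pos_of_mem_nhds μ hnhds).ne' h0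
  · have huniv : A = Set.univ :=
      hAc.ae_eq_univ_iff_eq.1 ((prob_compl_eq_zero_iff hAc.measurableSet).2 h1 |> ae_eq_univ.2)
    have hxA : x ∈ A := huniv ▸ Set.mem_univ x
    exact hxA 0 (hxV rfl)

lemma measurePreserving_contAut (γ : ↥(ContAut K)) :
    MeasurePreserving (γ : MulAut K) μ μ := by
  have hmeas := (ContAut.continuous γ).measurable
  refine ⟨hmeas, ?_⟩
  have := MulEquiv.isHaarMeasure_map μ (γ : MulAut K) (ContAut.continuous γ)
    (ContAut.continuous_symm γ)
  have := Measure.isProbabilityMeasure_map (μ := μ) hmeas.aemeasurable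
  exact Measure.isHaarMeasure_eq_of_isProbabilityMeasure _ _

lemma continuous_measureReal_inter_preimage_mul {A : Set K} (hA : MeasurableSet A) :
    Continuous fun x : K => μ.real (A ∩ (x * ·) ⁻¹' A) := by
  have hcurry : Continuous fun x : K => (⟨(x * ·), continuous_const_mul x⟩ : C(K, K)) :=
    ContinuousMap.continuous_of_continuous_uncurry _ continuous_mul
  rw [continuous_iff_continuousAt]
  intro x
  have htends := tendsto_measure_symmDiff_preimage_nhds_zero (μ := μ) (ν := μ)
    (hcurry.tendsto x) (.of_forall fun y => measurePreserving_mul_left μ y)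
    (measurePreserving_mul_left μ x) hA.nullMeasurableSet (measure_ne_top μ A)
  have htends' := (ENNReal.tendsto_toReal ENNReal.zero_ne_top).comp htends
  rw [ContinuousAt, tendsto_iff_dist_tendsto_zero]
  refine squeeze_zero (fun _ => dist_nonneg) (fun y => ?_) htends'
  have hm : ∀ z : K, MeasurableSet ((z * ·) ⁻¹' A) := fun z => measurable_const_mul z hA
  rw [Real.dist_eq]
  refine (abs_measureReal_sub_le_measureReal_symmDiff 
    (hA.inter (hm y)).nullMeasurableSet (hA.inter (hm x)).nullMeasurableSet).trans ?_
  refine measureReal_mono ?_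
  intro z hz
  rcases hz with ⟨⟨h1, h2⟩, h3⟩ | ⟨⟨h1, h2⟩, h3⟩
  · exact Or.inl ⟨h2, fun h => h3 ⟨h1, h⟩⟩
  · exact Or.inr ⟨h2, fun h => h3 ⟨h1, h⟩⟩

lemma ergAut_of_invariantKernel_eq_top {γ : ↥(ContAut K)} (h : invariantKernel γ = ⊤) :
    ErgAut μ γ := by
  intro A hA hinv
  have hpre : ∀ (m : ℤ) y, ((γ ^ m : ↥(ContAut K)) : MulAut K) y ∈ A ↔ y ∈ A := fun m y => by
    conv_lhs => rw [← hinv _ ⟨m, rfl⟩]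
    exact (MulEquiv.injective _).mem_set_image
  have hm : ∀ z : K, MeasurableSet ((z * ·) ⁻¹' A) := fun z => measurable_const_mul z hA
  have hconst : ∀ x : K, μ.real (A ∩ (x * ·) ⁻¹' A) = μ.real A := by
    intro x
    have hx : x ∈ invariantKernel γ := h ▸ Subgroup.mem_top x
    have := hx (fun x => μ.real (A ∩ (x * ·) ⁻¹' A))
      (continuous_measureReal_inter_preimage_mul μ hA) (fun m y => ?_) 1 1
    · simpa using this
    · rw [← (measurePreserving_contAut μ (γ ^ m)).measureReal_preimage
        (hA.inter (hm _)).nullMeasurableSet]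
      congr 1
      ext z
      simp only [Set.mem_preimage, Set.mem_inter_iff, ← map_mul, hpre]
  have hae : ∀ x : K, (x • ·) ⁻¹' A =ᵐ[μ] A := by
    intro x
    have hμ : μ (A ∩ (x * ·) ⁻¹' A) = μ A :=
      (measureReal_eq_measureReal_iff (measure_ne_top _ _) (measure_ne_top _ _)).1 (hconst x)
    have h₁ := ae_eq_of_subset_of_measure_ge Set.inter_subset_left hμ.ge
      (hA.inter (hm x)).nullMeasurableSet (measure_ne_top _ _)
    have h₂ := ae_eq_of_subset_of_measure_ge (Set.inter_subset_right (s := A))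
      ((measure_preimage_mul μ x A).trans hμ.symm).le
      (hA.inter (hm x)).nullMeasurableSet (measure_ne_top _ _)
    exact h₂.symm.trans h₁
  have hsc : SecondCountableTopology K := by
    let := TopologicalSpace.metrizableSpaceMetric K
    infer_instance
  have hev := aeconst_of_forall_preimage_smul_ae_eq K hA.nullMeasurableSet hae
  rcases Filter.eventuallyConst_set'.1 hev with h0 | h1
  · exact Or.inl (ae_eq_empty.1 h0)
  · exact Or.inr ((prob_compl_eq_zero_iff hA).1 (ae_eq_univ.1 h1))

end Ergodic

/-- Lemma 4.3. Let `α, β` be commuting continuous automorphisms of a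
compact metrizable group `K` such that `Z(α, β)`, the group of continuous automorphisms
commuting with both `α` and `β`, has DCC on `K`. If `α` is ergodic on `K`, then
`α ^ i * β` is ergodic on `K` for all but finitely many integers `i > 0`. -/
theorem statement12 {K : Type*} [Group K] [TopologicalSpace K] [IsTopologicalGroup K]
    [CompactSpace K] [TopologicalSpace.MetrizableSpace K]
    [MeasurableSpace K] [BorelSpace K]
    (μ : Measure K) [μ.IsHaarMeasure] [IsProbabilityMeasure μ]
    (α β : ↥(ContAut K)) (hcomm : α * β = β * α)
    (hdcc : HasDCC {τ : ↥(ContAut K) | τ * α = α * τ ∧ τ * β = β * τ})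
    (hα : ErgAut μ α) :
    {i : ℤ | 0 < i ∧ ¬ ErgAut μ (α ^ i * β)}.Finite := by
  classical
  set Λ : Set ↥(ContAut K) := {τ | τ * α = α * τ ∧ τ * β = β * τ}
  have hαβ : Commute α β := hcomm
  have hαΛ : α ∈ Λ := ⟨rfl, hcomm⟩
  have hΛγ : ∀ (i : ℤ), ∀ τ ∈ Λ, Commute τ (α ^ i * β) := fun i τ hτ =>
    (Commute.zpow_right (show Commute τ α from hτ.1) i).mul_right hτ.2
  have hγΛ : ∀ i : ℤ, α ^ i * β ∈ Λ := fun i =>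
    ⟨((Commute.zpow_self α i).mul_left hαβ.symm).eq,
      ((hαβ.zpow_left i).mul_left (Commute.refl β)).eq⟩
  have hN : ∀ i : ℤ, IsClosedNormalInv Λ (invariantKernel (α ^ i * β)) := fun i =>
    invariantKernel_isClosedNormalInv (hΛγ i)
  by_contra hinf
  let e := Set.Infinite.natEmbedding _ hinf
  have he : Function.Injective fun n => (e n : ℤ) :=
    Subtype.val_injective.comp e.injective
  have hpair : ∀ i j : ℕ, i ≠ j → ∀ M, IsClosedNormalInv Λ M →
      invariantKernel (α ^ (e i : ℤ) * β) ≤ M → EquicontMod (α ^ (e j : ℤ) * β) M → M = ⊤ := by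
    intro i j hij M hM hle hjM
    have hne : (e j : ℤ) - e i ≠ 0 := sub_ne_zero.2 fun h => hij (he h).symm
    have hquot := hjM.mul_inv hM (hN (e i)) hle (hγΛ _) (hΛγ _ _ (hγΛ _))
      (equicontMod_invariantKernel _)
    have heq : α ^ (e j : ℤ) * β * (α ^ (e i : ℤ) * β)⁻¹ = α ^ ((e j : ℤ) - e i) := by
      rw [zpow_sub]
      group
    rw [heq] at hquot
    exact eq_top_of_ergAut μ hα hM.isClosed (hquot.of_zpow hM hαΛ hne)
  let N : ℕ → Subgroup K := fun n => invariantKernel (α ^ (e n : ℤ) * β)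
  obtain ⟨n, hn⟩ := hdcc (fun n => (Finset.range n).inf N)
    (fun n => (IsClosedNormalInv.finsetInf (fun i => hN (e i)) _).isClosed)
    (fun n => Finset.inf_mono (Finset.range_mono n.le_succ))
    (fun n => (IsClosedNormalInv.finsetInf (fun i => hN (e i)) _).mem_iff)
  have hle : (Finset.range n).inf N ≤ N n := by
    rw [← hn (n + 1) n.le_succ]
    exact Finset.inf_le (Finset.self_mem_range_succ n)
  exact (e n).2.2 (ergAut_of_invariantKernel_eq_top μ
    (eq_top_of_finsetInf_le (γ := fun n => α ^ (e n : ℤ) * β) (fun i => hγΛ _) (fun i => hN _)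
      (fun i => equicontMod_invariantKernel _) hpair (Finset.range n) n Finset.notMem_range_self _
      (hN _) hle (equicontMod_invariantKernel _)))

end ErgZd
end

section
/- Let K be a compact metrizable group and Γ a finitely generated group of commuting continuous automorphisms of K generated by α₁, …, α_n. Then there exists a chain {e} = K₀ ⊆ K₁ ⊆ ⋯ ⊆ K_n ⊆ K of closed normal subgroups of K, each invariant under every automorphism in Z(Γ), such that (1) for each i, α_i is ergodic on K_i/K_{i−1} and distal on K/K_i, and (2) Γ is ergodic on K_n and distal on K/K_n. Moreover, if Γ is ergodic on K then K_n = K. -/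
open MeasureTheory Topology Set

set_option linter.unusedVariables false

namespace ErgZd

variable {K : Type*}

open Filter
open scoped symmDiff

/-- A continuous length function on a topological group. -/
structure IsLength {H : Type*} [Group H] [TopologicalSpace H] (d : H → ℝ) : Prop where
  continuous : Continuous d
  nonneg : ∀ x, 0 ≤ d x
  one : d 1 = 0
  inv : ∀ x, d x⁻¹ = d x
  mul_le : ∀ x y, d (x * y) ≤ d x + d y

section Measure

/-- An ergodic group of automorphisms has a dense orbit outside any proper closed set. -/
lemma ErgSet.exists_dense_orbit {H : Type*} [Group H] [TopologicalSpace H] [MeasurableSpace H]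
    [BorelSpace H] [SecondCountableTopology H] {ν : Measure H}
    [ν.IsHaarMeasure] [IsProbabilityMeasure ν] {S : Subgroup ↥(ContAut H)}
    (hS : ErgSet ν (S : Set ↥(ContAut H))) {M : Set H} (hM : IsClosed M) (hM' : M ≠ univ) :
    ∃ x, x ∉ M ∧ Dense ((fun α : ↥(ContAut H) => (α : MulAut H) x) '' S) := by
  let 𝓑 := TopologicalSpace.countableBasis H
  let W : Set H → Set H := fun U => ⋃ s ∈ S, ⇑(s : MulAut H) ⁻¹' U
  have hae : ∀ᵐ x ∂ν, ∀ U ∈ 𝓑, x ∈ W U := by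
    rw [ae_ball_iff (TopologicalSpace.countable_countableBasis H)]
    intro U hU
    have hUo : IsOpen U := TopologicalSpace.isOpen_of_mem_countableBasis hU
    have hWo : IsOpen (W U) :=
      isOpen_biUnion fun s _ => hUo.preimage (ContAut.continuous s)
    have hUne : U.Nonempty := TopologicalSpace.nonempty_of_mem_countableBasis hU
    have hsub : U ⊆ W U := fun x hx => mem_biUnion (one_mem S) (by simpa using hx)
    have hpos : ν (W U) ≠ 0 := (hWo.measure_pos ν (hUne.mono hsub)).ne'
    have h1 : ν (W U) = 1 := by
      refine (hS _ hWo.measurableSet fun t ht => ?_).resolve_left hpos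
      ext y
      simp only [W, mem_image, mem_iUnion, mem_preimage, exists_prop]
      constructor
      · rintro ⟨x, ⟨s, hs, hx⟩, rfl⟩
        exact ⟨s * t⁻¹, mul_mem hs (inv_mem ht), by simpa using hx⟩
      · rintro ⟨s, hs, hy⟩
        exact ⟨((t⁻¹ : ↥(ContAut H)) : MulAut H) y,
          ⟨s * t, mul_mem hs ht, by simpa using hy⟩, by simp⟩
    rw [ae_iff]
    exact (prob_compl_eq_zero_iff hWo.measurableSet).2 h1
  have hMfreq : ∃ᵐ x ∂ν, x ∉ M := by
    rw [frequently_ae_iff]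
    exact (hM.isOpen_compl.measure_pos ν (nonempty_compl.2 hM')).ne'
  obtain ⟨x, hx, hxW⟩ := (hMfreq.and_eventually hae).exists
  refine ⟨x, hx, (TopologicalSpace.isBasis_countableBasis H).dense_iff.2 fun U hU _ => ?_⟩
  obtain ⟨s, hs, hsx⟩ := mem_iUnion₂.1 (hxW U hU)
  exact ⟨_, hsx, s, hs, rfl⟩

variable {H : Type*} [Group H] [TopologicalSpace H] [IsTopologicalGroup H] [CompactSpace H]
  [MeasurableSpace H] [BorelSpace H]

lemma ContAut.measurePreserving [T2Space H] (ν : Measure H) [ν.IsHaarMeasure]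
    [IsProbabilityMeasure ν] (q : ↥(ContAut H)) : MeasurePreserving ⇑(q : MulAut H) ν ν := by
  have hm : Measurable ⇑(q : MulAut H) := (ContAut.continuous q).measurable
  refine ⟨hm, ?_⟩
  have h1 : (ν.map ⇑(q : MulAut H)).IsHaarMeasure :=
    MulEquiv.isHaarMeasure_map ν (q : MulAut H) (ContAut.continuous q) (ContAut.continuous_symm q)
  have h2 : IsProbabilityMeasure (ν.map ⇑(q : MulAut H)) :=
    Measure.isProbabilityMeasure_map hm.aemeasurable
  exact Measure.isHaarMeasure_eq_of_isProbabilityMeasure _ _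

/-- The amount by which left translation moves a set of positive, non-full measure is a
non-zero length function, invariant under all automorphisms preserving the set. -/
lemma exists_isLength_of_measure_ne [SecondCountableTopology H] [T2Space H] (ν : Measure H)
    [ν.IsHaarMeasure] [IsProbabilityMeasure ν] {A : Set H} (hA : MeasurableSet A)
    (hA01 : ¬ (ν A = 0 ∨ ν A = 1)) :
    ∃ d : H → ℝ, IsLength d ∧ (∃ x, d x ≠ 0) ∧
      ∀ q : ↥(ContAut H), (q : MulAut H) '' A = A → ∀ x, d ((q : MulAut H) x) = d x := by
  let T : H → Set H := fun x => (fun z => x * z) ⁻¹' A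
  have hT : ∀ x, MeasurableSet (T x) := fun x => hA.preimage (measurable_const_mul x)
  have hmp : ∀ x : H, MeasurePreserving (fun z => x * z) ν ν := fun x =>
    measurePreserving_mul_left ν x
  have hTT : ∀ x y, (fun z => y * z) ⁻¹' (T x) = T (x * y) := fun x y => by
    ext z; simp [T, mul_assoc]
  have hT1 : T 1 = A := by ext z; simp [T]
  have htri : ∀ X Y Z : Set H, ν.real (X ∆ Z) ≤ ν.real (X ∆ Y) + ν.real (Y ∆ Z) := by
    intro X Y Z
    rw [Measure.real, Measure.real, Measure.real,
      ← ENNReal.toReal_add (measure_ne_top _ _) (measure_ne_top _ _)]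
    exact ENNReal.toReal_mono (by finiteness) (measure_symmDiff_le _ _ _)
  have hshift : ∀ x y z, ν.real (T (x * z) ∆ T (y * z)) = ν.real (T x ∆ T y) := by
    intro x y z
    rw [← hTT, ← hTT, ← preimage_symmDiff, Measure.real, Measure.real,
      (hmp z).measure_preimage ((hT x).symmDiff (hT y)).nullMeasurableSet]
  refine ⟨fun x => ν.real (T x ∆ A), ⟨?_, fun x => measureReal_nonneg, ?_, ?_, ?_⟩, ?_, ?_⟩
  · rw [continuous_iff_continuousAt]
    intro x
    let F : H → C(H, H) := fun y => ⟨fun z => y * z, by fun_prop⟩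
    have hF : Continuous F :=
      (ContinuousMap.curry ⟨fun p : H × H => p.1 * p.2, by fun_prop⟩).continuous
    have h0 := tendsto_measure_symmDiff_preimage_nhds_zero (μ := ν) (ν := ν) (hF.tendsto x)
      (.of_forall hmp) (hmp x) hA.nullMeasurableSet (measure_ne_top _ _)
    have h1 : Tendsto (fun y => ν.real (T y ∆ T x)) (𝓝 x) (𝓝 0) := by
      simpa using! (ENNReal.tendsto_toReal ENNReal.zero_ne_top).comp h0
    rw [ContinuousAt, tendsto_iff_norm_sub_tendsto_zero]
    refine squeeze_zero (fun _ => norm_nonneg _) (fun y => ?_) h1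
    rw [Real.norm_eq_abs, abs_le]
    have h2 := htri (T x) (T y) A
    have h3 := htri (T y) (T x) A
    rw [symmDiff_comm (T x) (T y)] at h2
    constructor <;> linarith
  · simp [hT1]
  · intro x
    have := hshift x⁻¹ 1 x
    rw [inv_mul_cancel, one_mul, hT1] at this
    change ν.real (T x⁻¹ ∆ A) = ν.real (T x ∆ A)
    rw [← this, symmDiff_comm]
  · intro x y
    have := hshift x 1 y
    rw [one_mul, hT1] at this
    change ν.real (T (x * y) ∆ A) ≤ ν.real (T x ∆ A) + ν.real (T y ∆ A)
    rw [← this]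
    exact htri _ _ _
  · by_contra! hd
    apply hA01
    have hconst : EventuallyConst A (ae ν) := by
      refine aeconst_of_forall_preimage_smul_ae_eq H hA.nullMeasurableSet fun g => ?_
      rw [← measure_symmDiff_eq_zero_iff]
      exact (measureReal_eq_zero_iff).1 (hd g)
    rcases eventuallyConst_set.1 hconst with h | h
    · right
      exact (prob_compl_eq_zero_iff hA).1 (mem_ae_iff.1 h)
    · left
      exact measure_eq_zero_iff_ae_notMem.2 h
  · intro q hq x
    have hpre : ∀ z, (q : MulAut H) z ∈ A ↔ z ∈ A := fun z => by
      conv_lhs => rw [← hq]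
      simp
    have := (ContAut.measurePreserving ν q).measure_preimage
      ((hT ((q : MulAut H) x)).symmDiff hA).nullMeasurableSet
    simp only [Measure.real]
    rw [← this, preimage_symmDiff]
    congr 3
    · ext z; simp [T, ← map_mul, hpre]
    · ext z; simp [hpre]

/-- A distal group of automorphisms of a non-trivial compact metrizable group preserves a
non-zero length function. -/
lemma exists_isLength_of_distalSet [SecondCountableTopology H] [T2Space H] [Nontrivial H]
    {S : Subgroup ↥(ContAut H)} (hS : DistalSet (S : Set ↥(ContAut H))) :
    ∃ d : H → ℝ, IsLength d ∧ (∃ x, d x ≠ 0) ∧ ∀ q ∈ S, ∀ x, d ((q : MulAut H) x) = d x := by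
  let ν : Measure H := Measure.haarMeasure ⊤
  have : IsProbabilityMeasure ν :=
    ⟨by simpa using Measure.haarMeasure_self (K₀ := (⊤ : TopologicalSpace.PositiveCompacts H))⟩
  by_cases herg : ErgSet ν (S : Set ↥(ContAut H))
  · obtain ⟨x, hx, hd⟩ := herg.exists_dense_orbit (isClosed_singleton (x := (1 : H)))
      (fun h => not_subsingleton H (subsingleton_univ_iff.1 (h ▸ subsingleton_singleton)))
    exact absurd (hd 1) (hS x hx)
  · simp only [ErgSet, not_forall] at herg
    obtain ⟨A, hA, hinv, hA01⟩ := herg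
    obtain ⟨d, hd, hne, hq⟩ := exists_isLength_of_measure_ne ν hA hA01
    exact ⟨d, hd, hne, fun q hqS => hq q (hinv q hqS)⟩

end Measure

section Distal

variable [Group K] [TopologicalSpace K]

/-- The automorphisms leaving a subgroup invariant. -/
def autStabilizer (N : Subgroup K) : Subgroup ↥(ContAut K) where
  carrier := {γ | ∀ x, x ∈ N ↔ (γ : MulAut K) x ∈ N}
  one_mem' := fun _ => Iff.rfl
  mul_mem' := fun {a b} ha hb x => (hb x).trans (ha _)
  inv_mem' := fun {a} ha x => by
    rw [ha (((a⁻¹ : ↥(ContAut K)) : MulAut K) x)]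
    simp

/-- A group of automorphisms leaves `N` invariant as soon as it maps `N` into itself. -/
lemma le_autStabilizer {N : Subgroup K} {S : Subgroup ↥(ContAut K)}
    (h : ∀ γ ∈ S, ∀ x ∈ N, (γ : MulAut K) x ∈ N) : S ≤ autStabilizer N := by
  refine fun γ hγ x => ⟨h γ hγ x, fun hx => ?_⟩
  simpa using h γ⁻¹ (inv_mem hγ) _ hx

/-- The orbit of a point under a group of automorphisms. -/
def autOrbit (S : Subgroup ↥(ContAut K)) (x : K) : Set K :=
  Set.image (fun γ : ↥(ContAut K) => (γ : MulAut K) x) S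

/-- Distality of the action induced on the coset space of `N`: an orbit closure meeting `N`
is that of a point of `N`. -/
def DistalMod (S : Subgroup ↥(ContAut K)) (N : Subgroup K) : Prop :=
  ∀ x, ∀ m ∈ N, m ∈ closure (autOrbit S x) → x ∈ N

lemma distalMod_bot_left [T1Space K] (N : Subgroup K) : DistalMod ⊥ N := by
  intro x m hm hx
  have : autOrbit (⊥ : Subgroup ↥(ContAut K)) x = {x} := by
    simp [autOrbit]
  rw [this, closure_singleton, mem_singleton_iff] at hx
  exact hx ▸ hm

/-- Distality passes to quotients: this is the factor theorem for distal actions, obtained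
from an idempotent in the enveloping semigroup. -/
lemma DistalMod.of_le [T2Space K] [CompactSpace K] [IsTopologicalGroup K]
    {S : Subgroup ↥(ContAut K)} {M N : Subgroup K} (h : DistalMod S M) (hMN : M ≤ N)
    (hN : IsClosed (N : Set K)) (hSN : S ≤ autStabilizer N) : DistalMod S N := by
  intro x m hm hmx
  let : TopologicalSpace (Function.End K) := inferInstanceAs (TopologicalSpace (K → K))
  have : T2Space (Function.End K) := inferInstanceAs (T2Space (K → K))
  have : CompactSpace (Function.End K) := inferInstanceAs (CompactSpace (K → K))
  let ι : ↥(ContAut K) → Function.End K := fun γ => ⇑(γ : MulAut K)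
  let E : Set (Function.End K) := closure (ι '' S)
  have heval : ∀ y : K, Continuous (fun u : Function.End K => u y) := fun y =>
    continuous_apply (A := fun _ : K => K) y
  have himage : ∀ y : K, (fun u : Function.End K => u y) '' E = closure (autOrbit S y) := by
    intro y
    rw [image_closure_of_isCompact isClosed_closure.isCompact (heval y).continuousOn, image_image]
    rfl
  have hmulr : ∀ r : Function.End K, Continuous (· * r) := fun r =>
    continuous_pi fun y => heval (r y)
  have hmull : ∀ γ : ↥(ContAut K), Continuous (fun u : Function.End K => ι γ * u) := fun γ =>
    continuous_pi fun y => (ContAut.continuous γ).comp (heval y)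
  have hEmul : ∀ u ∈ E, ∀ w ∈ E, u * w ∈ E := by
    have h1 : ∀ γ ∈ S, ∀ w ∈ E, ι γ * w ∈ E := by
      intro γ hγ w hw
      refine map_mem_closure (hmull γ) hw ?_
      rintro _ ⟨δ, hδ, rfl⟩
      exact ⟨γ * δ, mul_mem hγ hδ, rfl⟩
    intro u hu w hw
    have : u * w ∈ closure E := by
      refine map_mem_closure (f := fun v : Function.End K => v * w) (hmulr w) hu ?_
      rintro _ ⟨γ, hγ, rfl⟩
      exact h1 γ hγ w hw
    rwa [isClosed_closure.closure_eq] at this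
  have hEN : ∀ u ∈ E, ∀ y ∈ N, u y ∈ N := by
    intro u hu y hy
    refine closure_minimal (t := {u : Function.End K | u y ∈ (N : Set K)}) ?_
      (hN.preimage (heval y)) hu
    rintro _ ⟨γ, hγ, rfl⟩
    exact (hSN hγ y).1 hy
  have hEhom : ∀ u ∈ E, ∀ y z, u (y * z) = u y * u z := by
    intro u hu y z
    refine closure_minimal (t := {u : Function.End K | u (y * z) = u y * u z}) ?_
      (isClosed_eq (heval _) ((heval y).mul (heval z))) hu
    rintro _ ⟨γ, hγ, rfl⟩
    exact map_mul (γ : MulAut K) y z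
  obtain ⟨u, huE, hux⟩ : m ∈ (fun u : Function.End K => u x) '' E := by rwa [himage]
  obtain ⟨e, ⟨heE, hex⟩, hee⟩ := exists_idempotent_in_compact_subsemigroup hmulr
    (E ∩ {u : Function.End K | u x ∈ (N : Set K)}) ⟨u, huE, by simpa [hux] using hm⟩
    (isClosed_closure.inter (hN.preimage (heval x))).isCompact
    (fun v hv w hw => ⟨hEmul v hv.1 w hw.1, hEN v hv.1 _ hw.2⟩)
  have heex : e (e x) = e x := congrFun hee x
  have he1 : e (x * (e x)⁻¹) = 1 := by
    have := hEhom e heE (x * (e x)⁻¹) (e x)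
    rw [inv_mul_cancel_right, heex] at this
    exact right_eq_mul.mp this
  have hmem : x * (e x)⁻¹ ∈ M := by
    refine h _ 1 (one_mem M) ?_
    rw [← himage]
    exact ⟨e, heE, he1⟩
  simpa using mul_mem (hMN hmem) hex

/-- A length function on `L` vanishing on `M` and invariant under `S`; the values outside `L`
are irrelevant. -/
structure IsInvLength (S : Subgroup ↥(ContAut K)) (L M : Subgroup K) (d : K → ℝ) : Prop where
  continuousOn : ContinuousOn d L
  nonneg : ∀ x ∈ L, 0 ≤ d x
  eq_zero : ∀ x ∈ M, d x = 0
  inv : ∀ x ∈ L, d x⁻¹ = d x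
  mul_le : ∀ x ∈ L, ∀ y ∈ L, d (x * y) ≤ d x + d y
  act : ∀ γ ∈ S, ∀ x ∈ L, d ((γ : MulAut K) x) = d x

/-- Length functions on a topological group pull back along continuous homomorphisms. -/
lemma IsLength.exists_isInvLength {H : Type*} [Group H] [TopologicalSpace H] {d : H → ℝ}
    (hd : IsLength d) {S : Subgroup ↥(ContAut K)} {L M : Subgroup K} (hSL : S ≤ autStabilizer L)
    (π : ↥L →* H) (hπ : Continuous π) (hM : ∀ x : ↥L, (x : K) ∈ M → π x = 1) (hML : M ≤ L)
    (hact : ∀ γ, ∀ hγ : γ ∈ S, ∀ x : ↥L,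
      d (π ⟨(γ : MulAut K) x, (hSL hγ x).1 x.2⟩) = d (π x)) :
    ∃ d' : K → ℝ, IsInvLength S L M d' ∧ ∀ x : ↥L, d' x = d (π x) := by
  classical
  let d' : K → ℝ := fun x => if h : x ∈ L then d (π ⟨x, h⟩) else 0
  have hd' : ∀ x (hx : x ∈ L), d' x = d (π ⟨x, hx⟩) := fun x hx => dif_pos hx
  refine ⟨d', ⟨?_, ?_, ?_, ?_, ?_, ?_⟩, fun x => hd' x x.2⟩
  · rw [continuousOn_iff_continuous_domRestrict]
    exact (hd.continuous.comp hπ).congr fun x => (hd' x x.2).symm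
  · intro x hx
    rw [hd' x hx]
    exact hd.nonneg _
  · intro x hx
    rw [hd' x (hML hx), hM ⟨x, hML hx⟩ hx, hd.one]
  · intro x hx
    rw [hd' x hx, hd' _ (inv_mem hx), ← hd.inv (π ⟨x, hx⟩), ← map_inv]
    rfl
  · intro x hx y hy
    rw [hd' x hx, hd' y hy, hd' _ (mul_mem hx hy)]
    refine le_trans (le_of_eq ?_) (hd.mul_le _ _)
    rw [← map_mul]
    rfl
  · intro γ hγ x hx
    rw [hd' x hx, hd' _ ((hSL hγ x).1 hx)]
    exact hact γ hγ ⟨x, hx⟩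

/-- The largest normal subgroup inside `L` on which all invariant length functions vanish. -/
def lengthKernel (S : Subgroup ↥(ContAut K)) (L M : Subgroup K) [L.Normal] : Subgroup K where
  carrier := {x | x ∈ L ∧ ∀ d, IsInvLength S L M d → ∀ k : K, d (k * x * k⁻¹) = 0}
  one_mem' := ⟨one_mem L, fun d hd k => by simpa using hd.eq_zero 1 (one_mem M)⟩
  mul_mem' := by
    rintro x y ⟨hxL, hx⟩ ⟨hyL, hy⟩
    refine ⟨mul_mem hxL hyL, fun d hd k => ?_⟩
    have hxk := Subgroup.Normal.conj_mem ‹L.Normal› x hxL k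
    have hyk := Subgroup.Normal.conj_mem ‹L.Normal› y hyL k
    have h := hd.mul_le _ hxk _ hyk
    rw [hx d hd, hy d hd, conj_mul, add_zero] at h
    refine le_antisymm h (hd.nonneg _ ?_)
    exact Subgroup.Normal.conj_mem ‹L.Normal› _ (mul_mem hxL hyL) k
  inv_mem' := by
    rintro x ⟨hxL, hx⟩
    refine ⟨inv_mem hxL, fun d hd k => ?_⟩
    rw [← conj_inv, hd.inv _ (Subgroup.Normal.conj_mem ‹L.Normal› x hxL k), hx d hd]

section lengthKernel

variable {S : Subgroup ↥(ContAut K)} {L M : Subgroup K} [hL : L.Normal]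

lemma le_lengthKernel [hM : M.Normal] (hML : M ≤ L) : M ≤ lengthKernel S L M :=
  fun x hx => ⟨hML hx, fun _ hd k => hd.eq_zero _ (hM.conj_mem x hx k)⟩

lemma IsInvLength.eq_zero_of_mem_lengthKernel {d : K → ℝ} (hd : IsInvLength S L M d) {x : K}
    (hx : x ∈ lengthKernel S L M) : d x = 0 := by
  simpa using hx.2 d hd 1

instance normal_lengthKernel : (lengthKernel S L M).Normal where
  conj_mem x hx g := by
    refine ⟨hL.conj_mem x hx.1 g, fun d hd k => ?_⟩
    have := hx.2 d hd (k * g)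
    simpa only [mul_inv_rev, mul_assoc] using this

lemma isClosed_lengthKernel [IsTopologicalGroup K] (hLc : IsClosed (L : Set K)) :
    IsClosed (lengthKernel S L M : Set K) := by
  have : (lengthKernel S L M : Set K) = (L : Set K) ∩
      ⋂ (d : K → ℝ) (_ : IsInvLength S L M d) (k : K),
        (L : Set K) ∩ (fun x => d (k * x * k⁻¹)) ⁻¹' {0} := by
    ext x
    simp only [mem_inter_iff, mem_iInter, mem_preimage, mem_singleton_iff, SetLike.mem_coe]
    exact ⟨fun hx => ⟨hx.1, fun d hd k => ⟨hx.1, hx.2 d hd k⟩⟩,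
      fun hx => ⟨hx.1, fun d hd k => (hx.2 d hd k).2⟩⟩
  rw [this]
  refine hLc.inter (isClosed_iInter fun d => isClosed_iInter fun hd => isClosed_iInter fun k => ?_)
  refine ContinuousOn.preimage_isClosed_of_isClosed ?_ hLc isClosed_singleton
  exact hd.continuousOn.comp (by fun_prop) fun x hx => hL.conj_mem x hx k

lemma lengthKernel_invariant {G : Subgroup ↥(ContAut K)}
    (hcomm : ∀ g ∈ G, ∀ γ ∈ S, g * γ = γ * g) (hGL : G ≤ autStabilizer L)
    (hGM : G ≤ autStabilizer M) : G ≤ autStabilizer (lengthKernel S L M) := by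
  refine le_autStabilizer fun g hg x hx => ⟨(hGL hg x).1 hx.1, fun d hd k => ?_⟩
  have hdg : IsInvLength S L M (d ∘ ⇑(g : MulAut K)) := by
    refine ⟨hd.continuousOn.comp (ContAut.continuous g).continuousOn fun x hx => (hGL hg x).1 hx,
      fun x hx => hd.nonneg _ ((hGL hg x).1 hx), fun x hx => hd.eq_zero _ ((hGM hg x).1 hx),
      fun x hx => ?_, fun x hx y hy => ?_, fun γ hγ x hx => ?_⟩
    · simpa using hd.inv _ ((hGL hg x).1 hx)
    · simpa using hd.mul_le _ ((hGL hg x).1 hx) _ ((hGL hg y).1 hy)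
    · have h1 : (g : MulAut K) ((γ : MulAut K) x) = (γ : MulAut K) ((g : MulAut K) x) :=
        congrArg (fun δ : ↥(ContAut K) => (δ : MulAut K) x) (hcomm g hg γ hγ)
      change d ((g : MulAut K) ((γ : MulAut K) x)) = d ((g : MulAut K) x)
      rw [h1, hd.act γ hγ _ ((hGL hg x).1 hx)]
  have := hx.2 _ hdg (((g⁻¹ : ↥(ContAut K)) : MulAut K) k)
  simpa using this

/-- Modulo the length kernel `A` acts equicontinuously, so distality of a commuting group `B`
extends to the product of `A` and `B`. -/
lemma distalMod_lengthKernel [IsTopologicalGroup K] [CompactSpace K] [T2Space K]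
    {G A B : Subgroup ↥(ContAut K)} (hLc : IsClosed (L : Set K))
    (hprod : ∀ g ∈ G, ∃ a ∈ A, ∃ b ∈ B, g = a * b)
    (hAL : A ≤ autStabilizer L) (hBL : B ≤ autStabilizer L)
    (hB : DistalMod B (lengthKernel A L M)) (hG : DistalMod G L) :
    DistalMod G (lengthKernel A L M) := by
  intro x m hm hmx
  have hxL : x ∈ L := hG x m hm.1 hmx
  rw [autOrbit, mem_closure_iff_clusterPt, ← map_principal] at hmx
  obtain ⟨U, hUG, hUm⟩ := mapClusterPt_iff_ultrafilter.1 hmx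
  have hUG : ∀ᶠ g in (U : Filter ↥(ContAut K)), g ∈ G := hUG (mem_principal_self _)
  have : ∀ g : ↥(ContAut K), ∃ a b, g ∈ G → a ∈ A ∧ b ∈ B ∧ g = a * b := by
    intro g
    by_cases hg : g ∈ G
    · obtain ⟨a, ha, b, hb, h⟩ := hprod g hg
      exact ⟨a, b, fun _ => ⟨ha, hb, h⟩⟩
    · exact ⟨1, 1, fun h => absurd h hg⟩
  choose a b hab using this
  obtain ⟨y, hy⟩ : ∃ y, Tendsto (fun g => (b g : MulAut K) x) U (𝓝 y) :=
    ⟨_, (U.map fun g => (b g : MulAut K) x).le_nhds_lim⟩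
  have hbL : ∀ᶠ g in (U : Filter ↥(ContAut K)), (b g : MulAut K) x ∈ L :=
    hUG.mono fun g hg => (hBL (hab g hg).2.1 x).1 hxL
  have hyL : y ∈ L := hLc.mem_of_tendsto hy hbL
  have hyN : y ∈ lengthKernel A L M := by
    refine ⟨hyL, fun d hd k => le_antisymm ?_ (hd.nonneg _ (hL.conj_mem y hyL k))⟩
    obtain ⟨l, hl⟩ : ∃ l, Tendsto (fun g => (a g : MulAut K) k) U (𝓝 l) :=
      ⟨_, (U.map fun g => (a g : MulAut K) k).le_nhds_lim⟩
    have hd_tendsto : ∀ (f : ↥(ContAut K) → K) (z : K), z ∈ L → (∀ᶠ g in U, f g ∈ L) →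
        Tendsto f U (𝓝 z) → Tendsto (fun g => d (f g)) U (𝓝 (d z)) := by
      intro f z hz hfL hf
      exact (hd.continuousOn z hz).tendsto.comp
        (tendsto_nhdsWithin_iff.2 ⟨hf, hfL⟩)
    have h1 : Tendsto (fun g => d (k * (y * ((b g : MulAut K) x)⁻¹) * k⁻¹)) U (𝓝 (d 1)) := by
      refine hd_tendsto _ _ (one_mem L) ?_ ?_
      · exact hbL.mono fun g hg => hL.conj_mem _ (mul_mem hyL (inv_mem hg)) k
      · have := ((tendsto_const_nhds (x := y)).mul hy.inv)
        simpa using (tendsto_const_nhds (x := k)).mul this |>.mul (tendsto_const_nhds (x := k⁻¹))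
    have h2 : Tendsto (fun g => d ((a g : MulAut K) k * (g : MulAut K) x * ((a g : MulAut K) k)⁻¹))
        U (𝓝 (d (l * m * l⁻¹))) := by
      refine hd_tendsto _ _ (hL.conj_mem m hm.1 l) ?_ ((hl.mul hUm).mul hl.inv)
      filter_upwards [hUG, hbL] with g hg hgb
      refine hL.conj_mem _ ?_ _
      have := (hAL (hab g hg).1 _).1 hgb
      conv => rw [(hab g hg).2.2]
      exact this
    have h3 := h1.add h2
    rw [hm.2 d hd l, hd.eq_zero 1 (one_mem M), add_zero] at h3
    refine ge_of_tendsto h3 ?_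
    filter_upwards [hUG, hbL] with g hg hgb
    have hact : d ((a g : MulAut K) k * (g : MulAut K) x * ((a g : MulAut K) k)⁻¹) =
        d (k * (b g : MulAut K) x * k⁻¹) := by
      rw [← hd.act (a g) (hab g hg).1 _ (hL.conj_mem _ hgb k), map_mul, map_mul, map_inv]
      have : (g : MulAut K) x = (a g : MulAut K) ((b g : MulAut K) x) :=
        congrArg (fun δ : ↥(ContAut K) => (δ : MulAut K) x) (hab g hg).2.2
      rw [this]
    rw [hact]
    refine le_trans (le_of_eq ?_) (hd.mul_le _ (hL.conj_mem _ (mul_mem hyL (inv_mem hgb)) k) _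
      (hL.conj_mem _ hgb k))
    congr 1
    group
  refine hB x y hyN (mem_closure_of_tendsto hy (hUG.mono fun g hg => ?_))
  exact ⟨b g, (hab g hg).2.1, rfl⟩

end lengthKernel

/-- The closed normal invariant subgroups containing `M` modulo which `S` is distal. -/
structure IsDistalNormal (S : Subgroup ↥(ContAut K)) (M N : Subgroup K) : Prop where
  le : M ≤ N
  isClosed : IsClosed (N : Set K)
  normal : N.Normal
  invariant : S ≤ autStabilizer N
  distalMod : DistalMod S N

/-- The smallest closed normal invariant subgroup containing `M` modulo which `S` is distal. -/
def distalKernel (S : Subgroup ↥(ContAut K)) (M : Subgroup K) : Subgroup K :=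
  sInf {N | IsDistalNormal S M N}

lemma distalKernel_le {S : Subgroup ↥(ContAut K)} {M N : Subgroup K} (h : IsDistalNormal S M N) :
    distalKernel S M ≤ N := sInf_le h

lemma isDistalNormal_distalKernel (S : Subgroup ↥(ContAut K)) (M : Subgroup K) :
    IsDistalNormal S M (distalKernel S M) where
  le := le_sInf fun _ hN => hN.le
  isClosed := by
    rw [distalKernel, Subgroup.coe_sInf]
    exact isClosed_biInter fun _ hN => hN.isClosed
  normal := ⟨fun x hx g => Subgroup.mem_sInf.2 fun N hN =>
    hN.normal.conj_mem x (Subgroup.mem_sInf.1 hx N hN) g⟩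
  invariant := le_autStabilizer fun γ hγ x hx => Subgroup.mem_sInf.2 fun N hN =>
    (hN.invariant hγ x).1 (Subgroup.mem_sInf.1 hx N hN)
  distalMod := fun x m hm hmx => Subgroup.mem_sInf.2 fun N hN =>
    hN.distalMod x m (Subgroup.mem_sInf.1 hm N hN) hmx

/-- The distal kernel is invariant under automorphisms commuting with the action. -/
lemma distalKernel_invariant {S G : Subgroup ↥(ContAut K)} {M : Subgroup K}
    (hcomm : ∀ g ∈ G, ∀ γ ∈ S, g * γ = γ * g) (hGM : G ≤ autStabilizer M) :
    G ≤ autStabilizer (distalKernel S M) := by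
  refine le_autStabilizer fun g hg x hx => Subgroup.mem_sInf.2 fun N hN => ?_
  have hcomm' : ∀ γ ∈ S, ∀ y, (g : MulAut K) ((γ : MulAut K) y) =
      (γ : MulAut K) ((g : MulAut K) y) := fun γ hγ y =>
    congrArg (fun δ : ↥(ContAut K) => (δ : MulAut K) y) (hcomm g hg γ hγ)
  have h : IsDistalNormal S M (N.comap ((g : MulAut K) : K ≃* K).toMonoidHom) := by
    refine ⟨fun y hy => hN.le ((hGM hg y).1 hy), hN.isClosed.preimage (ContAut.continuous g),
      hN.normal.comap _, le_autStabilizer fun γ hγ y hy => ?_, fun y m hm hmy => ?_⟩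
    · change (g : MulAut K) ((γ : MulAut K) y) ∈ N
      rw [hcomm' γ hγ]
      exact (hN.invariant hγ _).1 hy
    · refine hN.distalMod _ ((g : MulAut K) m) hm (map_mem_closure (ContAut.continuous g) hmy ?_)
      rintro _ ⟨γ, hγ, rfl⟩
      exact ⟨γ, hγ, (hcomm' γ hγ y).symm⟩
  exact distalKernel_le h hx

/-- Invariant length functions on the distal kernel vanish. -/
lemma IsInvLength.eq_zero_of_mem_distalKernel [IsTopologicalGroup K] [CompactSpace K] [T2Space K]
    {S : Subgroup ↥(ContAut K)} {M : Subgroup K} [M.Normal]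
    (hS : ∀ g ∈ S, ∀ γ ∈ S, g * γ = γ * g) (hSM : S ≤ autStabilizer M) {d : K → ℝ}
    (hd : IsInvLength S (distalKernel S M) M d) {x : K} (hx : x ∈ distalKernel S M) :
    d x = 0 := by
  have hL := isDistalNormal_distalKernel S M
  have := hL.normal
  refine hd.eq_zero_of_mem_lengthKernel (distalKernel_le (N := lengthKernel S _ M) ?_ hx)
  refine ⟨le_lengthKernel hL.le, isClosed_lengthKernel hL.isClosed, inferInstance,
    lengthKernel_invariant hS hL.invariant hSM, ?_⟩
  exact distalMod_lengthKernel (B := ⊥) hL.isClosed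
    (fun g hg => ⟨g, hg, 1, one_mem _, (mul_one g).symm⟩) hL.invariant bot_le
    (distalMod_bot_left _) hL.distalMod

end Distal

section Quotient

variable [Group K] [TopologicalSpace K]

/-- Distality modulo `N` yields distality of the induced maps on `p : P → H`, where `P` is a
subgroup of `K` and `p` is the quotient map by `N`. -/
lemma DistalMod.distalSet {P H : Type*} [Group P] [TopologicalSpace P] [CompactSpace P]
    [Group H] [TopologicalSpace H] [T2Space H] {A : Subgroup ↥(ContAut K)} {N : Subgroup K}
    (h : DistalMod A N) (j : P →* K) (hj : Continuous j) (p : P →* H) (hp : Continuous p)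
    (hps : Function.Surjective p) (hker : ∀ x, p x = 1 ↔ j x ∈ N) {Q : Set ↥(ContAut H)}
    (hQ : ∀ q ∈ Q, ∃ a ∈ A, ∀ x, ∃ y, j y = (a : MulAut K) (j x) ∧ (q : MulAut H) (p x) = p y) :
    DistalSet Q := by
  intro z hz hcl
  obtain ⟨x, rfl⟩ := hps z
  have hsub : (fun q : ↥(ContAut H) => (q : MulAut H) (p x)) '' Q ⊆
      p '' (j ⁻¹' autOrbit A (j x)) := by
    rintro _ ⟨q, hq, rfl⟩
    obtain ⟨a, ha, haq⟩ := hQ q hq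
    obtain ⟨y, hy, hqy⟩ := haq x
    exact ⟨y, ⟨a, ha, hy.symm⟩, hqy.symm⟩
  have h1 := closure_mono hsub hcl
  rw [← image_closure_of_isCompact isClosed_closure.isCompact hp.continuousOn] at h1
  obtain ⟨m, hm, hpm⟩ := h1
  refine hz ((hker x).2 (h _ (j m) ((hker m).1 hpm) ?_))
  exact closure_mono (image_preimage_subset _ _) (image_closure_subset_closure_image hj ⟨m, hm, rfl⟩)

lemma quotAut_zpow_mk (N : Subgroup K) [N.Normal] (α : ↥(ContAut K))
    (h : ∀ x, x ∈ N ↔ (α : MulAut K) x ∈ N) (k : ℤ) (x : K) :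
    ((quotAut N α h ^ k : ↥(ContAut (K ⧸ N))) : MulAut (K ⧸ N)) (x : K ⧸ N) =
      (((α ^ k : ↥(ContAut K)) : MulAut K) x : K) := by
  induction k generalizing x with
  | zero => rfl
  | succ k ih =>
    rw [zpow_add_one, zpow_add_one]
    exact ih _
  | pred k ih =>
    rw [zpow_sub_one, zpow_sub_one]
    exact ih _

/-- The automorphisms of `L / M` induced by a group of automorphisms of `K`. -/
def inducedAut (A : Subgroup ↥(ContAut K)) (L M : Subgroup K) [M.Normal]
    (hAL : A ≤ autStabilizer L) : Subgroup ↥(ContAut (↥L ⧸ M.subgroupOf L)) where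
  carrier := {q | ∃ a ∈ A, ∀ x y : ↥L, (y : K) = (a : MulAut K) x →
    (q : MulAut (↥L ⧸ M.subgroupOf L)) (x : ↥L ⧸ M.subgroupOf L) = (y : ↥L ⧸ M.subgroupOf L)}
  one_mem' := ⟨1, one_mem A, fun x y h => by
    rw [show y = x from Subtype.ext h]
    rfl⟩
  mul_mem' := by
    rintro q r ⟨a, ha, hq⟩ ⟨b, hb, hr⟩
    refine ⟨a * b, mul_mem ha hb, fun x y h => ?_⟩
    have := hr x ⟨(b : MulAut K) x, (hAL hb x).1 x.2⟩ rfl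
    change (q : MulAut (↥L ⧸ M.subgroupOf L)) ((r : MulAut (↥L ⧸ M.subgroupOf L)) x) = y
    rw [this]
    exact hq _ _ h
  inv_mem' := by
    rintro q ⟨a, ha, hq⟩
    refine ⟨a⁻¹, inv_mem ha, fun x y h => ?_⟩
    have := hq y x (by rw [h]; simp)
    rw [← this]
    exact (q : MulAut (↥L ⧸ M.subgroupOf L)).symm_apply_apply _

lemma quotAut_restrictAut_mem_inducedAut {A : Subgroup ↥(ContAut K)} {L M : Subgroup K} [M.Normal]
    (hAL : A ≤ autStabilizer L) {a : ↥(ContAut K)} (ha : a ∈ A)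
    (h : ∀ x, x ∈ M.subgroupOf L ↔
      ((restrictAut L a (hAL ha) : ↥(ContAut ↥L)) : MulAut ↥L) x ∈ M.subgroupOf L) :
    quotAut (M.subgroupOf L) (restrictAut L a (hAL ha)) h ∈ inducedAut A L M hAL :=
  ⟨a, ha, fun x y hxy => by rw [show y = ⟨_, (hAL ha x).1 x.2⟩ from Subtype.ext hxy]; rfl⟩

variable [IsTopologicalGroup K]

lemma DistalMod.distalSet_quotAut [CompactSpace K] {S : Subgroup ↥(ContAut K)} {N : Subgroup K}
    [N.Normal] (h : DistalMod S N) (hN : IsClosed (N : Set K)) (hinv : S ≤ autStabilizer N) :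
    DistalSet {q : ↥(ContAut (K ⧸ N)) | ∃ γ, ∃ hγ : γ ∈ S, q = quotAut N γ (hinv hγ)} := by
  refine h.distalSet (MonoidHom.id K) continuous_id (QuotientGroup.mk' N)
    QuotientGroup.continuous_mk (QuotientGroup.mk'_surjective N)
    (fun x => QuotientGroup.eq_one_iff x) ?_
  rintro _ ⟨γ, hγ, rfl⟩
  exact ⟨γ, hγ, fun x => ⟨(γ : MulAut K) x, rfl, rfl⟩⟩

lemma DistalMod.distalAut_quotAut [CompactSpace K] {N : Subgroup K} [N.Normal] {α : ↥(ContAut K)}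
    (h : DistalMod (Subgroup.zpowers α) N) (hN : IsClosed (N : Set K))
    (hinv : ∀ x, x ∈ N ↔ (α : MulAut K) x ∈ N) : DistalAut (quotAut N α hinv) := by
  refine h.distalSet (MonoidHom.id K) continuous_id (QuotientGroup.mk' N)
    QuotientGroup.continuous_mk (QuotientGroup.mk'_surjective N)
    (fun x => QuotientGroup.eq_one_iff x) ?_
  rintro _ ⟨k, rfl⟩
  exact ⟨α ^ k, ⟨k, rfl⟩, fun x => ⟨((α ^ k : ↥(ContAut K)) : MulAut K) x, rfl,
    quotAut_zpow_mk N α hinv k x⟩⟩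

/-- If `A` is distal modulo `M`, then it preserves a non-zero length function on any larger
closed subgroup. -/
lemma DistalMod.exists_isInvLength [CompactSpace K] [SecondCountableTopology K] [T2Space K]
    {A : Subgroup ↥(ContAut K)} {L M : Subgroup K} [M.Normal] (hA : DistalMod A M)
    (hLc : IsClosed (L : Set K)) (hMc : IsClosed (M : Set K)) (hML : M < L)
    (hAL : A ≤ autStabilizer L) (hAM : A ≤ autStabilizer M) :
    ∃ d, IsInvLength A L M d ∧ ∃ x ∈ L, d x ≠ 0 := by
  have : CompactSpace ↥L := isCompact_iff_compactSpace.1 hLc.isCompact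
  have : IsClosed (M.subgroupOf L : Set ↥L) := hMc.preimage continuous_subtype_val
  obtain ⟨x₀, hx₀L, hx₀M⟩ := SetLike.exists_of_lt hML
  have : Nontrivial (↥L ⧸ M.subgroupOf L) :=
    ⟨((⟨x₀, hx₀L⟩ : ↥L) : ↥L ⧸ M.subgroupOf L), 1, fun h => hx₀M <| by
      simpa [Subgroup.mem_subgroupOf] using (QuotientGroup.eq_one_iff _).1 h⟩
  have : SecondCountableTopology ↥L :=
    TopologicalSpace.Subtype.secondCountableTopology (L : Set K)
  borelize (↥L ⧸ M.subgroupOf L)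
  have hdist : DistalSet (inducedAut A L M hAL : Set ↥(ContAut (↥L ⧸ M.subgroupOf L))) := by
    refine hA.distalSet L.subtype continuous_subtype_val (QuotientGroup.mk' _)
      QuotientGroup.continuous_mk (QuotientGroup.mk'_surjective _)
      (fun x => (QuotientGroup.eq_one_iff x).trans Subgroup.mem_subgroupOf) ?_
    rintro q ⟨a, ha, hq⟩
    exact ⟨a, ha, fun x => ⟨⟨_, (hAL ha x).1 x.2⟩, rfl, hq _ _ rfl⟩⟩
  obtain ⟨d, hd, ⟨z, hz⟩, hinv⟩ := exists_isLength_of_distalSet hdist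
  obtain ⟨d', hd', hdd'⟩ := hd.exists_isInvLength (M := M) hAL (QuotientGroup.mk' (M.subgroupOf L))
    QuotientGroup.continuous_mk
    (fun x hx => (QuotientGroup.eq_one_iff x).2 (Subgroup.mem_subgroupOf.2 hx)) hML.le
    (fun γ hγ x => hinv _ (quotAut_restrictAut_mem_inducedAut hAL hγ
      fun y => by
        rw [Subgroup.mem_subgroupOf, Subgroup.mem_subgroupOf]
        exact hAM hγ y) x)
  obtain ⟨x, rfl⟩ := QuotientGroup.mk'_surjective _ z
  refine ⟨d', hd', x, x.2, ?_⟩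
  rwa [hdd' x]

/-- The product of two commuting distal groups of automorphisms is distal. -/
lemma DistalMod.of_mul [CompactSpace K] [SecondCountableTopology K] [T2Space K]
    {G A B : Subgroup ↥(ContAut K)} {M : Subgroup K} [M.Normal] (hMc : IsClosed (M : Set K))
    (hG : ∀ g ∈ G, ∀ h ∈ G, g * h = h * g) (hAG : A ≤ G) (hBG : B ≤ G)
    (hprod : ∀ g ∈ G, ∃ a ∈ A, ∃ b ∈ B, g = a * b) (hGM : G ≤ autStabilizer M)
    (hA : DistalMod A M) (hB : DistalMod B M) : DistalMod G M := by
  have hL := isDistalNormal_distalKernel G M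
  have := hL.normal
  rcases hL.le.eq_or_lt with h | hlt
  · rw [h]
    exact hL.distalMod
  · exfalso
    obtain ⟨d, hd, x, hxL, hx⟩ := hA.exists_isInvLength hL.isClosed hMc hlt
      (hAG.trans hL.invariant) (hAG.trans hGM)
    refine hx (hd.eq_zero_of_mem_lengthKernel (distalKernel_le (S := G) ?_ hxL))
    have hinv : G ≤ autStabilizer (lengthKernel A (distalKernel G M) M) :=
      lengthKernel_invariant (fun g hg γ hγ => hG g hg γ (hAG hγ)) hL.invariant hGM
    have hcl : IsClosed (lengthKernel A (distalKernel G M) M : Set K) :=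
      isClosed_lengthKernel hL.isClosed
    exact ⟨le_lengthKernel hL.le, hcl, inferInstance, hinv,
      distalMod_lengthKernel hL.isClosed hprod (hAG.trans hL.invariant) (hBG.trans hL.invariant)
        (hB.of_le (le_lengthKernel hL.le) hcl (hBG.trans hinv)) hL.distalMod⟩

/-- A group generated by finitely many commuting distal automorphisms is distal. -/
lemma distalMod_closure [CompactSpace K] [SecondCountableTopology K] [T2Space K]
    {Γ : Subgroup ↥(ContAut K)} {M : Subgroup K} [M.Normal] (hMc : IsClosed (M : Set K))
    (hΓ : ∀ g ∈ Γ, ∀ h ∈ Γ, g * h = h * g) (hΓM : Γ ≤ autStabilizer M)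
    {T : Set ↥(ContAut K)} (hT : T.Finite) (hTΓ : T ⊆ Γ)
    (hdist : ∀ a ∈ T, DistalMod (Subgroup.zpowers a) M) :
    DistalMod (Subgroup.closure T) M := by
  induction T, hT using Set.Finite.induction_on with
  | empty =>
    rw [Subgroup.closure_empty]
    exact distalMod_bot_left M
  | @insert a T _ _ ih =>
    have hle : Subgroup.closure (insert a T) ≤ Γ := (Subgroup.closure_le _).2 hTΓ
    have hA : Subgroup.zpowers a ≤ Subgroup.closure (insert a T) :=
      Subgroup.zpowers_le.2 (Subgroup.subset_closure (mem_insert a T))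
    have hB : Subgroup.closure T ≤ Subgroup.closure (insert a T) :=
      Subgroup.closure_mono (subset_insert a T)
    refine DistalMod.of_mul (A := Subgroup.zpowers a) (B := Subgroup.closure T) hMc
      (fun g hg h hh => hΓ g (hle hg) h (hle hh)) hA hB (fun g hg => ?_) (hle.trans hΓM)
      (hdist a (mem_insert a T))
      (ih ((subset_insert a T).trans hTΓ) fun b hb => hdist b (mem_insert_of_mem a hb))
    induction hg using Subgroup.closure_induction with
    | mem g hg =>
      rcases hg with rfl | hg
      · exact ⟨g, Subgroup.mem_zpowers g, 1, one_mem _, (mul_one g).symm⟩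
      · exact ⟨1, one_mem _, g, Subgroup.subset_closure hg, (one_mul g).symm⟩
    | one => exact ⟨1, one_mem _, 1, one_mem _, (one_mul 1).symm⟩
    | mul g h _ _ ihg ihh =>
      obtain ⟨c, hc, b, hb, rfl⟩ := ihg
      obtain ⟨c', hc', b', hb', rfl⟩ := ihh
      refine ⟨c * c', mul_mem hc hc', b * b', mul_mem hb hb', ?_⟩
      have : Commute b c' := hΓ b (hle (hB hb)) c' (hle (hA hc'))
      exact this.mul_mul_mul_comm c b'
    | inv g _ ihg =>
      obtain ⟨c, hc, b, hb, rfl⟩ := ihg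
      refine ⟨c⁻¹, inv_mem hc, b⁻¹, inv_mem hb, ?_⟩
      rw [hΓ c (hle (hA hc)) b (hle (hB hb)), mul_inv_rev]

end Quotient

section Chain

variable [Group K] [TopologicalSpace K] {n : ℕ}

/-- Each term is the distal kernel of the next generator relative to the previous term. -/
def distalChain (α : Fin n → ↥(ContAut K)) : ℕ → Subgroup K
  | 0 => ⊥
  | i + 1 => if h : i < n then distalKernel (Subgroup.zpowers (α ⟨i, h⟩)) (distalChain α i)
      else distalChain α i

variable (α : Fin n → ↥(ContAut K))

lemma distalChain_succ (i : Fin n) :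
    distalChain α (i + 1) = distalKernel (Subgroup.zpowers (α i)) (distalChain α i) := by
  simp [distalChain]

lemma distalChain_succ_of_le {i : ℕ} (h : n ≤ i) : distalChain α (i + 1) = distalChain α i := by
  simp [distalChain, h]

lemma distalChain_eq_of_le {i : ℕ} (h : n ≤ i) : distalChain α i = distalChain α n := by
  induction i, h using Nat.le_induction with
  | base => rfl
  | succ i hi ih => rw [distalChain_succ_of_le α hi, ih]

lemma distalChain_induction {P : Subgroup K → Prop} (h0 : P ⊥)
    (hsucc : ∀ i : Fin n, P (distalChain α i) →
      P (distalKernel (Subgroup.zpowers (α i)) (distalChain α i))) (i : ℕ) :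
    P (distalChain α i) := by
  induction i with
  | zero => exact h0
  | succ i ih =>
    by_cases h : i < n
    · rw [distalChain_succ α ⟨i, h⟩]
      exact hsucc ⟨i, h⟩ ih
    · rwa [distalChain_succ_of_le α (not_lt.1 h)]

lemma distalChain_le_succ (i : ℕ) : distalChain α i ≤ distalChain α (i + 1) := by
  by_cases h : i < n
  · rw [distalChain_succ α ⟨i, h⟩]
    exact (isDistalNormal_distalKernel _ _).le
  · rw [distalChain_succ_of_le α (not_lt.1 h)]

lemma monotone_distalChain : Monotone (distalChain α) :=
  monotone_nat_of_le_succ (distalChain_le_succ α)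

lemma normal_distalChain (i : ℕ) : (distalChain α i).Normal :=
  distalChain_induction α (P := fun N => N.Normal) inferInstance
    (fun _ _ => (isDistalNormal_distalKernel _ _).normal) i

lemma isClosed_distalChain [T1Space K] (i : ℕ) : IsClosed (distalChain α i : Set K) :=
  distalChain_induction α (P := fun N => IsClosed (N : Set K)) (by simp)
    (fun _ _ => (isDistalNormal_distalKernel _ _).isClosed) i

lemma distalChain_invariant {Z : Subgroup ↥(ContAut K)} (hZ : ∀ β ∈ Z, ∀ i, β * α i = α i * β)
    (i : ℕ) : Z ≤ autStabilizer (distalChain α i) := by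
  refine distalChain_induction α (P := fun N => Z ≤ autStabilizer N)
    (le_autStabilizer fun γ _ x hx => ?_) (fun i hi => ?_) i
  · rw [Subgroup.mem_bot] at hx ⊢
    rw [hx, map_one]
  · refine distalKernel_invariant ?_ hi
    rintro β hβ _ ⟨k, rfl⟩
    exact Commute.zpow_right (hZ β hβ i) k

lemma commute_of_mem_zpowers {G : Type*} [Group G] (a : G) :
    ∀ g ∈ Subgroup.zpowers a, ∀ h ∈ Subgroup.zpowers a, g * h = h * g := by
  rintro _ ⟨k, rfl⟩ _ ⟨l, rfl⟩
  exact zpow_mul_comm a k l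

lemma zpowers_le_autStabilizer_distalChain {α : Fin n → ↥(ContAut K)}
    (hcomm : ∀ i j, α i * α j = α j * α i) (j : Fin n) (i : ℕ) :
    Subgroup.zpowers (α j) ≤ autStabilizer (distalChain α i) := by
  refine distalChain_invariant α ?_ i
  rintro _ ⟨k, rfl⟩ i
  exact Commute.zpow_left (hcomm j i) k

end Chain

section Ergodic

variable [Group K] [TopologicalSpace K]

lemma coe_restrictAut_zpow (L : Subgroup K) (a : ↥(ContAut K))
    (h : ∀ x, x ∈ L ↔ (a : MulAut K) x ∈ L) (k : ℤ) (x : ↥L) :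
    ((((restrictAut L a h ^ k : ↥(ContAut ↥L)) : MulAut ↥L) x : ↥L) : K) =
      ((a ^ k : ↥(ContAut K)) : MulAut K) x := by
  induction k generalizing x with
  | zero => rfl
  | succ k ih =>
    rw [zpow_add_one, zpow_add_one]
    exact ih _
  | pred k ih =>
    rw [zpow_sub_one, zpow_sub_one]
    exact ih _

lemma IsInvLength.mono {S T : Subgroup ↥(ContAut K)} {L L' M M' : Subgroup K} {d : K → ℝ}
    (hd : IsInvLength S L M d) (hTS : T ≤ S) (hL : L' ≤ L) (hM : ∀ x ∈ M', d x = 0) :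
    IsInvLength T L' M' d :=
  ⟨hd.continuousOn.mono hL, fun x hx => hd.nonneg x (hL hx), hM, fun x hx => hd.inv x (hL hx),
    fun x hx y hy => hd.mul_le x (hL hx) y (hL hy), fun γ hγ x hx => hd.act γ (hTS hγ) x (hL hx)⟩

variable [IsTopologicalGroup K] [CompactSpace K] [T2Space K]

lemma IsInvLength.eq_zero_of_mem_distalChain {n : ℕ} {α : Fin n → ↥(ContAut K)}
    (hcomm : ∀ i j, α i * α j = α j * α i) {S : Subgroup ↥(ContAut K)} (hαS : ∀ i, α i ∈ S)
    {L : Subgroup K} {d : K → ℝ} (hd : IsInvLength S L ⊥ d) {i : ℕ} (hi : distalChain α i ≤ L) :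
    ∀ x ∈ distalChain α i, d x = 0 := by
  induction i with
  | zero => exact hd.eq_zero
  | succ i ih =>
    have ih := ih ((distalChain_le_succ α i).trans hi)
    by_cases h : i < n
    · intro x hx
      have := normal_distalChain α i
      rw [distalChain_succ α ⟨i, h⟩] at hi hx
      exact (hd.mono (Subgroup.zpowers_le.2 (hαS ⟨i, h⟩)) hi ih).eq_zero_of_mem_distalKernel
        (commute_of_mem_zpowers _) (zpowers_le_autStabilizer_distalChain hcomm _ _) hx
    · rwa [distalChain_succ_of_le α (not_lt.1 h)]

variable [SecondCountableTopology K] [MeasurableSpace K] [BorelSpace K]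

/-- If every invariant length function on `L` modulo `M` vanishes, the action on `L / M`
is ergodic. -/
lemma ergAut_quotAut_restrictAut {L M : Subgroup K} [M.Normal] (hLc : IsClosed (L : Set K))
    (hMc : IsClosed (M : Set K)) (hML : M ≤ L) {a : ↥(ContAut K)}
    (haL : ∀ x, x ∈ L ↔ (a : MulAut K) x ∈ L)
    (haM : ∀ x, x ∈ M.subgroupOf L ↔
      ((restrictAut L a haL : ↥(ContAut ↥L)) : MulAut ↥L) x ∈ M.subgroupOf L)
    (hzero : ∀ d, IsInvLength (Subgroup.zpowers a) L M d → ∀ x ∈ L, d x = 0)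
    (ν : Measure (↥L ⧸ M.subgroupOf L)) [ν.IsHaarMeasure] [IsProbabilityMeasure ν] :
    ErgAut ν (quotAut (M.subgroupOf L) (restrictAut L a haL) haM) := by
  intro A hA hAinv
  by_contra h01
  have : CompactSpace ↥L := isCompact_iff_compactSpace.1 hLc.isCompact
  have : IsClosed (M.subgroupOf L : Set ↥L) := hMc.preimage continuous_subtype_val
  have : SecondCountableTopology ↥L :=
    TopologicalSpace.Subtype.secondCountableTopology (L : Set K)
  have : PolishSpace ↥L := by
    let := TopologicalSpace.metrizableSpaceMetric ↥L
    infer_instance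
  obtain ⟨d, hd, ⟨z, hz⟩, hinv⟩ := exists_isLength_of_measure_ne ν hA h01
  obtain ⟨d', hd', hdd'⟩ := hd.exists_isInvLength (M := M)
    (Subgroup.zpowers_le.2 haL : Subgroup.zpowers a ≤ autStabilizer L)
    (QuotientGroup.mk' (M.subgroupOf L)) QuotientGroup.continuous_mk
    (fun x hx => (QuotientGroup.eq_one_iff x).2 (Subgroup.mem_subgroupOf.2 hx)) hML (by
      rintro _ ⟨k, rfl⟩ x
      refine Eq.trans (congrArg d ?_) (hinv _ (hAinv _ ⟨k, rfl⟩) (x : ↥L ⧸ M.subgroupOf L))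
      refine Eq.trans ?_ (quotAut_zpow_mk _ _ haM k x).symm
      exact congrArg _ (Subtype.ext (coe_restrictAut_zpow L a haL k x).symm))
  obtain ⟨x, rfl⟩ := QuotientGroup.mk'_surjective _ z
  exact hz (by rw [← hdd', hzero d' hd' x x.2])

/-- If every invariant length function on `L` vanishes, the action on `L` is ergodic. -/
lemma ergSet_restrictAut {L : Subgroup K} (hLc : IsClosed (L : Set K))
    {S : Subgroup ↥(ContAut K)} (hSL : S ≤ autStabilizer L)
    (hzero : ∀ d, IsInvLength S L ⊥ d → ∀ x ∈ L, d x = 0)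
    (ν : Measure ↥L) [ν.IsHaarMeasure] [IsProbabilityMeasure ν] :
    ErgSet ν {e | ∃ γ, ∃ hγ : γ ∈ S, e = restrictAut L γ (hSL hγ)} := by
  intro A hA hAinv
  by_contra h01
  have : CompactSpace ↥L := isCompact_iff_compactSpace.1 hLc.isCompact
  have : SecondCountableTopology ↥L :=
    TopologicalSpace.Subtype.secondCountableTopology (L : Set K)
  obtain ⟨d, hd, ⟨z, hz⟩, hinv⟩ := exists_isLength_of_measure_ne ν hA h01
  obtain ⟨d', hd', hdd'⟩ := hd.exists_isInvLength (M := ⊥) hSL (MonoidHom.id ↥L) continuous_id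
    (fun x hx => Subtype.ext (Subgroup.mem_bot.1 hx)) bot_le
    (fun γ hγ x => hinv _ (hAinv _ ⟨γ, hγ, rfl⟩) x)
  exact hz (by rw [← hzero d' hd' z z.2, hdd']; rfl)

end Ergodic


/-- Proposition 4.4. For a finitely generated group `Γ` of commuting
continuous automorphisms of a compact metrizable group `K` generated by `α 1, …, α n`,
there is a chain `⊥ = C 0 ≤ C 1 ≤ ⋯ ≤ C n ≤ K` of closed normal `Z(Γ)`-invariant
subgroups such that each `α i` is ergodic on `C i / C (i-1)` and distal on `K / C i`,
`Γ` is ergodic on `C n` and distal on `K / C n`; and if `Γ` is ergodic on `K`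
then `C n = K`. -/
theorem statement13 {K : Type*} [Group K] [TopologicalSpace K] [IsTopologicalGroup K]
    [CompactSpace K] [TopologicalSpace.MetrizableSpace K]
    [MeasurableSpace K] [BorelSpace K]
    (μ : Measure K) [μ.IsHaarMeasure] [IsProbabilityMeasure μ]
    {n : ℕ} (α : Fin n → ↥(ContAut K))
    (hcomm : ∀ i j, α i * α j = α j * α i)
    (Γ : Subgroup ↥(ContAut K)) (hΓ : Γ = Subgroup.closure (Set.range α))
    (hmem : ∀ i, α i ∈ Γ) :
    ∃ (C : ℕ → Subgroup K) (hnorm : ∀ i, (C i).Normal)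
      (hinvΓ : ∀ i, ∀ γ ∈ Γ, ∀ x : K, x ∈ C i ↔ (γ : MulAut K) x ∈ C i),
      C 0 = ⊥ ∧ (∀ i, C i ≤ C (i + 1)) ∧ (∀ i, n ≤ i → C i = C n) ∧
      (∀ i, IsClosed (C i : Set K)) ∧
      (∀ i, ∀ β : ↥(ContAut K), (∀ γ ∈ Γ, β * γ = γ * β) →
        ∀ x : K, x ∈ C i ↔ (β : MulAut K) x ∈ C i) ∧
      (∀ i : Fin n,
        haveI : ((C (i : ℕ)).subgroupOf (C ((i : ℕ) + 1))).Normal :=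
          (hnorm (i : ℕ)).subgroupOf _
        haveI : (C ((i : ℕ) + 1)).Normal := hnorm ((i : ℕ) + 1)
        (∀ ν : Measure (↥(C ((i : ℕ) + 1)) ⧸ (C (i : ℕ)).subgroupOf (C ((i : ℕ) + 1))),
          ν.IsHaarMeasure → IsProbabilityMeasure ν →
          ErgAut ν (quotAut ((C (i : ℕ)).subgroupOf (C ((i : ℕ) + 1)))
            (restrictAut (C ((i : ℕ) + 1)) (α i) (hinvΓ _ (α i) (hmem i)))
            (fun x => by
              rw [Subgroup.mem_subgroupOf, Subgroup.mem_subgroupOf]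
              exact hinvΓ (i : ℕ) (α i) (hmem i) (x : K))))
        ∧ DistalAut (quotAut (C ((i : ℕ) + 1)) (α i) (hinvΓ _ (α i) (hmem i)))) ∧
      (∀ ν : Measure ↥(C n), ν.IsHaarMeasure → IsProbabilityMeasure ν →
        ErgSet ν {e | ∃ γ, ∃ hγ : γ ∈ Γ, e = restrictAut (C n) γ (hinvΓ n γ hγ)}) ∧
      (haveI : (C n).Normal := hnorm n
       DistalSet {q : ↥(ContAut (K ⧸ C n)) | ∃ γ, ∃ hγ : γ ∈ Γ,
         q = quotAut (C n) γ (hinvΓ n γ hγ)}) ∧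
      (ErgSet μ (Γ : Set ↥(ContAut K)) → C n = ⊤) := by
  let := TopologicalSpace.metrizableSpaceMetric K
  have hΓα : ∀ β : ↥(ContAut K), (∀ i, β * α i = α i * β) → ∀ γ ∈ Γ, β * γ = γ * β := by
    intro β hβ γ hγ
    have : Γ ≤ Subgroup.centralizer {β} := by
      rw [hΓ, Subgroup.closure_le]
      rintro _ ⟨i, rfl⟩
      exact Subgroup.mem_centralizer_singleton_iff.2 (hβ i).symm
    exact (Subgroup.mem_centralizer_singleton_iff.1 (this hγ)).symm
  have hΓcomm : ∀ g ∈ Γ, ∀ h ∈ Γ, g * h = h * g := fun g hg =>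
    hΓα g fun i => (hΓα (α i) (hcomm i) g hg).symm
  have hclosed := isClosed_distalChain α
  have hnorm := normal_distalChain α
  have hinvΓ : ∀ i, Γ ≤ autStabilizer (distalChain α i) :=
    distalChain_invariant α fun β hβ i => hΓcomm β hβ (α i) (hmem i)
  have hdistal : ∀ i : Fin n, DistalMod (Subgroup.zpowers (α i)) (distalChain α (i + 1)) := by
    intro i
    rw [distalChain_succ]
    exact (isDistalNormal_distalKernel _ _).distalMod
  have hΓdistal : DistalMod Γ (distalChain α n) := by
    have := hnorm n
    rw [hΓ]
    refine distalMod_closure (hclosed n) hΓcomm (hinvΓ n) (finite_range α)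
      (range_subset_iff.2 hmem) ?_
    rintro _ ⟨i, rfl⟩
    exact (hdistal i).of_le (monotone_distalChain α i.2) (hclosed n)
      (zpowers_le_autStabilizer_distalChain hcomm i n)
  refine ⟨distalChain α, hnorm, fun i γ hγ => hinvΓ i hγ, rfl, distalChain_le_succ α,
    fun i => distalChain_eq_of_le α, hclosed, fun i β hβ => ?_, fun i => ⟨fun ν hν hν' => ?_, ?_⟩,
    fun ν hν hν' => ?_, ?_, fun herg => ?_⟩
  · refine distalChain_invariant α (Z := Subgroup.zpowers β) ?_ i (Subgroup.mem_zpowers β)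
    rintro _ ⟨k, rfl⟩ j
    exact Commute.zpow_left (hβ _ (hmem j)) k
  · have := hnorm i
    refine ergAut_quotAut_restrictAut (hclosed _) (hclosed _) (distalChain_le_succ α i) _ _
      (fun d hd x hx => ?_) ν
    rw [distalChain_succ] at hd hx
    exact hd.eq_zero_of_mem_distalKernel (commute_of_mem_zpowers _)
      (zpowers_le_autStabilizer_distalChain hcomm i i) hx
  · have := hnorm (i + 1)
    exact (hdistal i).distalAut_quotAut (hclosed _) _
  · exact ergSet_restrictAut (hclosed n) (hinvΓ n)
      (fun d hd => hd.eq_zero_of_mem_distalChain hcomm hmem le_rfl) ν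
  · have := hnorm n
    exact hΓdistal.distalSet_quotAut (hclosed n) (hinvΓ n)
  · by_contra hne
    obtain ⟨x, hx, hdense⟩ := herg.exists_dense_orbit (hclosed n)
      (fun h => hne (SetLike.coe_injective (h.trans Subgroup.coe_top.symm)))
    exact hx (hΓdistal x 1 (one_mem _) (hdense 1))

end ErgZd
end
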